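/- arXiv:1804.02517 — 3 statements merged into one kernel-verified Lean document; each statement's English description precedes it below -/
import Mathlib

section
/- Let X be a nondegenerate Peano continuum having a free arc, which is neither an arc nor a circle. Then for any free open interval I ⊆ X, there is a unique maximal free open interval J of X containing I. -/
open Set Metric Topology

/-- The whole space `X` is an arc, i.e. homeomorphic to `[0,1]`. -/
def SpaceIsArc (X : Type*) [TopologicalSpace X] : Prop :=
  Nonempty (X ≃ₜ Set.Icc (0:ℝ) 1)

/-- The whole space `X` is a circle, i.e. homeomorphic to the unit circle in `ℂ`. -/
def SpaceIsCircle (X : Type*) [TopologicalSpace X] : Prop :=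
  Nonempty (X ≃ₜ Metric.sphere (0:ℂ) 1)

/-- A subset `A` is an arc: with the subspace topology it is homeomorphic to `[0,1]`. -/
def IsArc {X : Type*} [TopologicalSpace X] (A : Set X) : Prop :=
  Nonempty (A ≃ₜ Set.Icc (0:ℝ) 1)

/-- A subset `A` is a circle: with the subspace topology it is homeomorphic to `S¹`. -/
def IsCircleSet {X : Type*} [TopologicalSpace X] (A : Set X) : Prop :=
  Nonempty (A ≃ₜ Metric.sphere (0:ℂ) 1)

/-- `A` is an arc with endpoints `a` and `b`: it is the image of a continuous
injective parametrization of `[0,1]` with `γ 0 = a` and `γ 1 = b`. -/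
def IsArcEnds {X : Type*} [TopologicalSpace X] (A : Set X) (a b : X) : Prop :=
  ∃ γ : ℝ → X, ContinuousOn γ (Set.Icc 0 1) ∧ Set.InjOn γ (Set.Icc 0 1) ∧
    γ '' Set.Icc 0 1 = A ∧ γ 0 = a ∧ γ 1 = b

/-- A free open interval: an open subset homeomorphic to `(0,1)`. -/
def IsFreeOpenInterval {X : Type*} [TopologicalSpace X] (J : Set X) : Prop :=
  IsOpen J ∧ Nonempty (J ≃ₜ Set.Ioo (0:ℝ) 1)

/-- A free arc: the closure of a free open interval, homeomorphic to `[0,1]`. -/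
def IsFreeArc {X : Type*} [TopologicalSpace X] (A : Set X) : Prop :=
  ∃ J : Set X, IsFreeOpenInterval J ∧ A = closure J ∧ IsArc A

/-- A maximal free open interval: no free open interval properly contains it. -/
def IsMaxFreeOpenInterval {X : Type*} [TopologicalSpace X] (J : Set X) : Prop :=
  IsFreeOpenInterval J ∧ ∀ K : Set X, IsFreeOpenInterval K → J ⊆ K → J = K

/-- `x` is an endpoint of the space `X`: every open set containing `x` contains an
open neighborhood of `x` whose boundary is a single point. -/
def IsEndpointOf (X : Type*) [TopologicalSpace X] (x : X) : Prop :=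
  ∀ U : Set X, IsOpen U → x ∈ U → ∃ V : Set X, IsOpen V ∧ x ∈ V ∧ V ⊆ U ∧
    ∃ y : X, frontier V = {y}

/-- A maximal free open interval of Type I: its closure is an arc `J ∪ {a,b}` with
`a, b ∉ J` and at least one of `a, b` an endpoint of `X`. -/
def IsTypeI {X : Type*} [TopologicalSpace X] (J : Set X) : Prop :=
  IsMaxFreeOpenInterval J ∧ ∃ a b : X, a ≠ b ∧ a ∉ J ∧ b ∉ J ∧
    closure J = J ∪ {a, b} ∧ IsArcEnds (closure J) a b ∧
    (IsEndpointOf X a ∨ IsEndpointOf X b)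

/-- The model simple triod in the complex plane: three unit segments from the
origin in directions `π/3`, `π`, `5π/3`. -/
noncomputable def triodModel : Set ℂ :=
  ⋃ θ ∈ ({Real.pi / 3, Real.pi, 5 * Real.pi / 3} : Set ℝ),
    (fun r : ℝ => (r : ℂ) * Complex.exp (θ * Complex.I)) '' Set.Icc (0:ℝ) 1

/-- `A` is a simple triod. -/
def IsSimpleTriod {X : Type*} [TopologicalSpace X] (A : Set X) : Prop :=
  Nonempty (A ≃ₜ triodModel)

/-- `U` contains no simple triod. -/
def ContainsNoTriod {X : Type*} [TopologicalSpace X] (U : Set X) : Prop :=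
  ∀ A : Set X, A ⊆ U → ¬ IsSimpleTriod A

/-- The distance between two subsets of a metric space:
`d(S,T) = inf { dist s t | s ∈ S, t ∈ T }`. -/
noncomputable def setDist {X : Type*} [MetricSpace X] (S T : Set X) : ℝ :=
  sInf (Set.image2 dist S T)

section

open Filter

theorem image_mem_nhds_of_continuousOn_injOn {f : ℝ → ℝ} {s : Set ℝ} {t : ℝ} (hs : s ∈ 𝓝 t)
    (hc : ContinuousOn f s) (hi : InjOn f s) : f '' s ∈ 𝓝 (f t) := by
  obtain ⟨ε, hε, hb⟩ := Metric.nhds_basis_closedBall.mem_iff.1 hs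
  rw [Real.closedBall_eq_Icc] at hb
  have hle : t - ε ≤ t + ε := by linarith
  have hl : t - ε ∈ Icc (t - ε) (t + ε) := left_mem_Icc.2 hle
  have hr : t + ε ∈ Icc (t - ε) (t + ε) := right_mem_Icc.2 hle
  have hm : t ∈ Icc (t - ε) (t + ε) := ⟨by linarith, by linarith⟩
  refine mem_of_superset ?_ (image_mono hb)
  rcases (hc.mono hb).strictMonoOn_of_injOn_Icc' hle (hi.mono hb) with h | h
  · exact mem_of_superset (Icc_mem_nhds (h hl hm (by linarith)) (h hm hr (by linarith)))
      (intermediate_value_Icc hle (hc.mono hb))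
  · exact mem_of_superset (Icc_mem_nhds (h hm hr (by linarith)) (h hl hm (by linarith)))
      (intermediate_value_Icc' hle (hc.mono hb))

theorem exists_continuous_injective_eqOn_Ioo {f : ℝ → ℝ} {c d B : ℝ} (hcd : c < d)
    (hc : ContinuousOn f (Ioo c d)) (hm : StrictMonoOn f (Ioo c d))
    (hB : ∀ x ∈ Ioo c d, |f x| ≤ B) :
    ∃ g : ℝ → ℝ, Continuous g ∧ Function.Injective g ∧ EqOn g f (Ioo c d) := by
  have hbelow : BddBelow (f '' Ioo c d) :=
    ⟨-B, by rintro _ ⟨x, hx, rfl⟩; exact (abs_le.1 (hB x hx)).1⟩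
  have habove : BddAbove (f '' Ioo c d) :=
    ⟨B, by rintro _ ⟨x, hx, rfl⟩; exact (abs_le.1 (hB x hx)).2⟩
  have hlc := hm.monotoneOn.tendsto_nhdsWithin_Ioo_right (nonempty_Ioo.2 hcd) hbelow
  have hld := hm.monotoneOn.tendsto_nhdsWithin_Ioo_left (nonempty_Ioo.2 hcd) habove
  have hFc : ContinuousOn (extendFrom (Ioo c d) f) (Icc c d) :=
    continuousOn_Icc_extendFrom_Ioo hc hlc hld
  have hFe : EqOn (extendFrom (Ioo c d) f) f (Ioo c d) :=
    extendFrom_extends hc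
  have hFl := eq_lim_at_left_extendFrom_Ioo hcd hlc
  have hFr := eq_lim_at_right_extendFrom_Ioo hcd hld
  generalize extendFrom (Ioo c d) f = F at hFc hFe hFl hFr
  have hl : ∀ x ∈ Ioo c d, F c < F x := fun x hx ↦ by
    obtain ⟨y, hcy, hyx⟩ := exists_between hx.1
    have hy : y ∈ Ioo c d := ⟨hcy, hyx.trans hx.2⟩
    rw [hFl, hFe hx]
    exact (csInf_le hbelow (mem_image_of_mem f hy)).trans_lt (hm hy hx hyx)
  have hr : ∀ x ∈ Ioo c d, F x < F d := fun x hx ↦ by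
    obtain ⟨y, hxy, hyd⟩ := exists_between hx.2
    have hy : y ∈ Ioo c d := ⟨hx.1.trans hxy, hyd⟩
    rw [hFr, hFe hx]
    exact (hm hx hy hxy).trans_le (le_csSup habove (mem_image_of_mem f hy))
  have hFm : StrictMonoOn F (Icc c d) := by
    intro x hx y hy hxy
    obtain ⟨z, hz⟩ := nonempty_Ioo.2 hcd
    rcases hx.1.eq_or_lt with rfl | hcx <;> rcases hy.2.eq_or_lt with rfl | hyd
    · exact (hl z hz).trans (hr z hz)
    · exact hl y ⟨hxy, hyd⟩
    · exact hr x ⟨hcx, hxy⟩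
    · have hx' : x ∈ Ioo c d := ⟨hcx, hxy.trans hyd⟩
      have hy' : y ∈ Ioo c d := ⟨hcx.trans hxy, hyd⟩
      rw [hFe hx', hFe hy']
      exact hm hx' hy' hxy
  have hgc : ∀ x ∈ Icc c d, IccExtend hcd.le (fun y : Icc c d ↦ F y) x +
      (x - projIcc c d hcd.le x) = F x := fun x hx ↦ by
    rw [IccExtend_of_mem _ _ hx, projIcc_of_mem _ hx]; simp
  refine ⟨fun x ↦ IccExtend hcd.le (fun y : Icc c d ↦ F y) x + (x - projIcc c d hcd.le x),
    ?_, StrictMono.injective ?_, ?_⟩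
  · exact hFc.domRestrict.Icc_extend'.add
      (continuous_id.sub (continuous_subtype_val.comp continuous_projIcc))
  · have h1 : StrictMonoOn (fun x ↦ IccExtend hcd.le (fun y : Icc c d ↦ F y) x +
        (x - projIcc c d hcd.le x)) (Iic c) := fun x hx y hy hxy ↦ by
      simp only [IccExtend_of_le_left _ _ (mem_Iic.1 hx), IccExtend_of_le_left _ _ (mem_Iic.1 hy),
        projIcc_of_le_left _ (mem_Iic.1 hx), projIcc_of_le_left _ (mem_Iic.1 hy)]
      linarith
    have h2 : StrictMonoOn (fun x ↦ IccExtend hcd.le (fun y : Icc c d ↦ F y) x +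
        (x - projIcc c d hcd.le x)) (Icc c d) := hFm.congr fun x hx ↦ (hgc x hx).symm
    have h3 : StrictMonoOn (fun x ↦ IccExtend hcd.le (fun y : Icc c d ↦ F y) x +
        (x - projIcc c d hcd.le x)) (Ici d) := fun x hx y hy hxy ↦ by
      simp only [IccExtend_of_right_le _ _ (mem_Ici.1 hx), IccExtend_of_right_le _ _ (mem_Ici.1 hy),
        projIcc_of_right_le _ (mem_Ici.1 hx), projIcc_of_right_le _ (mem_Ici.1 hy)]
      linarith
    refine StrictMonoOn.Iic_union_Ici ?_ h3
    rw [← Iic_union_Icc_eq_Iic hcd.le]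
    exact h1.union h2 isGreatest_Iic (isLeast_Icc hcd.le)
  · intro x hx
    exact (hgc x (Ioo_subset_Icc_self hx)).trans (hFe hx)

theorem exists_continuous_injective_eqOn {f : ℝ → ℝ} {s : Set ℝ} {B : ℝ} (hs : IsOpen s)
    (hsc : IsConnected s) (hbd : BddBelow s) (hba : BddAbove s) (hc : ContinuousOn f s)
    (hi : InjOn f s) (hB : ∀ x ∈ s, |f x| ≤ B) :
    ∃ g : ℝ → ℝ, Continuous g ∧ Function.Injective g ∧ EqOn g f s := by
  obtain ⟨c, d, rfl⟩ : ∃ c d, s = Ioo c d := by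
    refine ⟨sInf s, sSup s, (Subset.antisymm ?_ (hsc.Ioo_csInf_csSup_subset hbd hba))⟩
    rw [← interior_Icc]
    exact hs.subset_interior_iff.2 (subset_Icc_csInf_csSup hbd hba)
  have hcd : c < d := nonempty_Ioo.1 hsc.nonempty
  rcases hc.strictMonoOn_of_injOn_Ioo hcd hi with hm | hm
  · exact exists_continuous_injective_eqOn_Ioo hcd hc hm hB
  · obtain ⟨g, hg, hgi, he⟩ := exists_continuous_injective_eqOn_Ioo hcd hc.neg
      (fun x hx y hy hxy ↦ neg_lt_neg (hm hx hy hxy))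
      (fun x hx ↦ (abs_neg (f x)).trans_le (hB x hx))
    refine ⟨-g, hg.neg, neg_injective.comp hgi, fun x hx ↦ ?_⟩
    simp [he hx]

theorem nonempty_homeomorph_Ioo {a b : ℝ} (hab : a < b) : Nonempty (ℝ ≃ₜ Ioo a b) := by
  have h2 : 0 < (b - a) / 2 := by linarith
  refine ⟨(orderIsoIooNegOneOne ℝ).toHomeomorph.trans
    ((affineHomeomorph ((b - a) / 2) ((a + b) / 2) h2.ne').subtype fun x ↦ ?_)⟩
  simp only [mem_Ioo, affineHomeomorph_apply]
  constructor <;> rintro ⟨h, h'⟩ <;> constructor <;> nlinarith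

variable {X : Type*} [TopologicalSpace X]

theorem isFreeOpenInterval_iff {J : Set X} :
    IsFreeOpenInterval J ↔ ∃ h : ℝ → X, IsOpenEmbedding h ∧ range h = J := by
  obtain ⟨φ⟩ := nonempty_homeomorph_Ioo (zero_lt_one (α := ℝ))
  constructor
  · rintro ⟨hJ, ⟨e⟩⟩
    exact ⟨_, hJ.isOpenEmbedding_subtypeVal.comp (φ.trans e.symm).isOpenEmbedding, by
      rw [(φ.trans e.symm).surjective.range_comp, Subtype.range_coe]⟩
  · rintro ⟨h, hh, rfl⟩
    exact ⟨hh.isOpen_range, ⟨hh.isEmbedding.toHomeomorph.symm.trans φ⟩⟩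

theorem IsFreeOpenInterval.isConnected {J : Set X} (hJ : IsFreeOpenInterval J) :
    IsConnected J := by
  obtain ⟨h, hh, rfl⟩ := isFreeOpenInterval_iff.1 hJ
  exact isConnected_range hh.continuous

/-- A point with an open neighbourhood homeomorphic to the real line. -/
def IsLinePoint (x : X) : Prop :=
  ∃ g : ℝ → X, IsOpenEmbedding g ∧ g 0 = x

theorem IsFreeOpenInterval.isLinePoint {J : Set X} (hJ : IsFreeOpenInterval J) {x : X}
    (hx : x ∈ J) : IsLinePoint x := by
  obtain ⟨h, hh, rfl⟩ := isFreeOpenInterval_iff.1 hJ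
  obtain ⟨t, rfl⟩ := hx
  exact ⟨_, hh.comp (Homeomorph.addRight t).isOpenEmbedding, by simp⟩

theorem IsLinePoint.image_mem_nhds {x : X} (hx : IsLinePoint x) {f : X → ℝ} {s : Set X}
    (hs : s ∈ 𝓝 x) (hc : ContinuousOn f s) (hi : InjOn f s) : f '' s ∈ 𝓝 (f x) := by
  obtain ⟨g, hg, rfl⟩ := hx
  have h := image_mem_nhds_of_continuousOn_injOn (f := f ∘ g) (s := g ⁻¹' s)
    (hg.continuous.continuousAt hs) (hc.comp hg.continuous.continuousOn (mapsTo_preimage g s))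
    (hi.comp hg.injective.injOn (mapsTo_preimage g s))
  refine mem_of_superset h ?_
  rw [image_comp]
  exact image_mono (image_preimage_subset g s)

theorem isOpenEmbedding_of_isLinePoint {k : ℝ → X} (hk : Continuous k)
    (hi : Function.Injective k) (hl : ∀ t, IsLinePoint (k t)) : IsOpenEmbedding k := by
  refine .of_continuous_injective_isOpenMap hk hi (.of_nhds_le fun t s hs ↦ ?_)
  obtain ⟨g, hg, hgt⟩ := hl t
  let e := hg.toOpenPartialHomeomorph g
  have het : k t ∈ e.target := by simp [e, ← hgt]
  have hV : k ⁻¹' e.target ∈ 𝓝 t := hk.continuousAt (e.open_target.mem_nhds het)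
  have h := image_mem_nhds_of_continuousOn_injOn (f := e.symm ∘ k)
    (s := k ⁻¹' e.target ∩ k ⁻¹' s)
    (inter_mem hV hs)
    (e.continuousOn_symm.comp hk.continuousOn (fun x hx ↦ hx.1))
    (e.symm.injOn.comp hi.injOn (fun x hx ↦ hx.1))
  have h' := hg.isOpenMap.image_mem_nhds h
  have hgt' : g ((e.symm ∘ k) t) = k t := e.right_inv het
  rw [hgt'] at h'
  refine mem_of_superset h' ?_
  rintro _ ⟨_, ⟨u, hu, rfl⟩, rfl⟩
  have : g ((e.symm ∘ k) u) = k u := e.right_inv hu.1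
  rw [this]
  exact hu.2

theorem isFreeOpenInterval_of_continuousOn_injOn {U : Set X} (hU : IsOpen U)
    (hUc : IsConnected U) (hl : ∀ x ∈ U, IsLinePoint x) {f : X → ℝ} (hc : ContinuousOn f U)
    (hi : InjOn f U) : IsFreeOpenInterval U := by
  set F : U → ℝ := fun x ↦ Real.arctan (f x) with hF
  have hFc : Continuous F := Real.continuous_arctan.comp hc.domRestrict
  have hFi : Function.Injective F := fun x y hxy ↦
    Subtype.ext (hi x.2 y.2 (Real.arctan_injective hxy))
  have hFo : IsOpenMap F := by
    refine .of_nhds_le fun x s hs ↦ ?_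
    rw [mem_map, ← hU.isOpenEmbedding_subtypeVal.image_mem_nhds] at hs
    have hsU : Subtype.val '' (F ⁻¹' s) ⊆ U := by rintro _ ⟨y, -, rfl⟩; exact y.2
    refine mem_of_superset ((hl x x.2).image_mem_nhds hs (f := fun x ↦ Real.arctan (f x))
      (Real.continuous_arctan.comp_continuousOn (hc.mono hsU))
      (Real.arctan_injective.comp_injOn (hi.mono hsU))) ?_
    rintro _ ⟨_, ⟨y, hy, rfl⟩, rfl⟩
    exact hy
  have hFe := IsOpenEmbedding.of_continuous_injective_isOpenMap hFc hFi hFo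
  have : ConnectedSpace U := isConnected_iff_connectedSpace.1 hUc
  obtain ⟨a, b, hab⟩ : ∃ a b, range F = Ioo a b := by
    have hbd : BddBelow (range F) :=
      ⟨-(Real.pi / 2), by rintro _ ⟨x, rfl⟩; exact (Real.neg_pi_div_two_lt_arctan _).le⟩
    have hba : BddAbove (range F) :=
      ⟨Real.pi / 2, by rintro _ ⟨x, rfl⟩; exact (Real.arctan_lt_pi_div_two _).le⟩
    refine ⟨sInf (range F), sSup (range F), (Subset.antisymm ?_
      ((isConnected_range hFc).Ioo_csInf_csSup_subset hbd hba))⟩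
    rw [← interior_Icc]
    exact hFe.isOpen_range.subset_interior_iff.2 (subset_Icc_csInf_csSup hbd hba)
  have hlt : a < b := by
    rw [← nonempty_Ioo, ← hab]; exact (isConnected_range hFc).nonempty
  obtain ⟨φ⟩ := nonempty_homeomorph_Ioo hlt
  obtain ⟨ψ⟩ := nonempty_homeomorph_Ioo (zero_lt_one (α := ℝ))
  exact ⟨hU, ⟨hFe.isEmbedding.toHomeomorph.trans ((Homeomorph.setCongr hab).trans
    (φ.symm.trans ψ))⟩⟩

theorem IsFreeOpenInterval.exists_extension {K L : Set X} (hK : IsFreeOpenInterval K)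
    (hL : IsFreeOpenInterval L) (hKL : K ⊆ L) {f : X → ℝ} (hc : ContinuousOn f K)
    (hi : InjOn f K) (hb : ∃ B, ∀ x ∈ K, |f x| ≤ B) :
    ∃ g : X → ℝ, ContinuousOn g L ∧ InjOn g L ∧ (∃ B, ∀ x ∈ L, |g x| ≤ B) ∧ EqOn g f K := by
  obtain ⟨B, hB⟩ := hb
  obtain ⟨h, hh, rfl⟩ := isFreeOpenInterval_iff.1 hL
  obtain ⟨φ⟩ := nonempty_homeomorph_Ioo (zero_lt_one (α := ℝ))
  have hj : IsOpenEmbedding fun t ↦ (φ t : ℝ) :=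
    isOpen_Ioo.isOpenEmbedding_subtypeVal.comp φ.isOpenEmbedding
  let e := (hh.toOpenPartialHomeomorph h).symm.trans (hj.toOpenPartialHomeomorph _)
  have hes : e.source = range h := by simp [e]
  have het : e.target ⊆ Ioo 0 1 := by
    rintro x hx
    have := e.right_inv hx
    rw [← this]
    simp only [e, OpenPartialHomeomorph.coe_trans]
    exact (φ _).2
  rw [← hes] at hKL ⊢
  have hsub : e '' K ⊆ Ioo 0 1 := by
    rintro _ ⟨x, hx, rfl⟩
    exact het (e.map_source (hKL hx))
  have hsym : MapsTo e.symm (e '' K) K := by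
    rintro _ ⟨x, hx, rfl⟩
    rwa [e.left_inv (hKL hx)]
  obtain ⟨g, hgc, hgi, hge⟩ := exists_continuous_injective_eqOn (f := f ∘ e.symm) (s := e '' K)
    (B := B) (e.isOpen_image_of_subset_source hK.1 hKL)
    (hK.isConnected.image _ (e.continuousOn.mono hKL))
    (bddBelow_Ioo.mono hsub) (bddAbove_Ioo.mono hsub)
    (hc.comp (e.continuousOn_symm.mono (e.mapsTo.mono_left hKL).image_subset) hsym)
    (hi.comp (e.symm.injOn.mono (e.mapsTo.mono_left hKL).image_subset) hsym)
    (fun x hx ↦ hB _ (hsym hx))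
  refine ⟨g ∘ e, hgc.comp_continuousOn e.continuousOn, hgi.comp_injOn e.injOn, ?_, fun x hx ↦ ?_⟩
  · obtain ⟨C, hC⟩ := (isCompact_Icc (a := (0 : ℝ)) (b := 1)).exists_bound_of_continuousOn
      hgc.continuousOn
    exact ⟨C, fun x hx ↦ hC _ (Ioo_subset_Icc_self (het (e.map_source hx)))⟩
  · rw [Function.comp_apply, hge (mem_image_of_mem e hx), Function.comp_apply,
      e.left_inv (hKL hx)]

theorem isFreeOpenInterval_iUnion_of_monotone {K : ℕ → Set X}
    (hK : ∀ n, IsFreeOpenInterval (K n)) (hm : Monotone K) : IsFreeOpenInterval (⋃ n, K n) := by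
  let P : ℕ → (X → ℝ) → Prop := fun n f ↦
    ContinuousOn f (K n) ∧ InjOn f (K n) ∧ ∃ B, ∀ x ∈ K n, |f x| ≤ B
  have h0 : ∃ f, P 0 f := by
    obtain ⟨-, ⟨e⟩⟩ := hK 0
    classical
    have hv : ∀ x : K 0, (if hx : (x : X) ∈ K 0 then (e ⟨x, hx⟩ : ℝ) else 0) = e x := fun x ↦
      dif_pos x.2
    refine ⟨fun x ↦ if hx : x ∈ K 0 then (e ⟨x, hx⟩ : ℝ) else 0, ?_, ?_, 1, ?_⟩
    · rw [continuousOn_iff_continuous_domRestrict]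
      exact (continuous_subtype_val.comp e.continuous).congr fun x ↦ (hv x).symm
    · intro x hx y hy hxy
      simp only [dif_pos hx, dif_pos hy] at hxy
      simpa using e.injective (Subtype.ext hxy)
    · intro x hx
      simp only [dif_pos hx]
      have := (e ⟨x, hx⟩).2
      rw [abs_le]
      constructor <;> linarith [this.1, this.2]
  have hstep : ∀ n f, P n f → ∃ g, P (n + 1) g ∧ EqOn g f (K n) := fun n f hf ↦ by
    obtain ⟨g, h1, h2, h3, h4⟩ :=
      (hK n).exists_extension (hK (n + 1)) (hm n.le_succ) hf.1 hf.2.1 hf.2.2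
    exact ⟨g, ⟨h1, h2, h3⟩, h4⟩
  choose! step hstepP hstepE using hstep
  obtain ⟨f0, hf0⟩ := h0
  let f : ℕ → X → ℝ := fun n ↦ Nat.rec f0 step n
  have hf : ∀ n, P n (f n) := fun n ↦ by
    induction n with
    | zero => exact hf0
    | succ n ih => exact hstepP n _ ih
  have hfe : ∀ n m, n ≤ m → EqOn (f m) (f n) (K n) := fun n m hnm ↦ by
    induction m, hnm using Nat.le_induction with
    | base => exact fun x _ ↦ rfl
    | succ m hnm ih => exact fun x hx ↦ (hstepE m _ (hf m) (hm hnm hx)).trans (ih hx)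
  classical
  let F : X → ℝ := fun x ↦ if hx : ∃ n, x ∈ K n then f (Nat.find hx) x else 0
  have hF : ∀ n, EqOn F (f n) (K n) := fun n x hx ↦ by
    have hx' : ∃ n, x ∈ K n := ⟨n, hx⟩
    simp only [F, dif_pos hx']
    exact (hfe _ _ (Nat.find_min' hx' hx) (Nat.find_spec hx')).symm
  refine isFreeOpenInterval_of_continuousOn_injOn (f := F)
    (isOpen_iUnion fun n ↦ (hK n).1) ?_ ?_ ?_ ?_
  · obtain ⟨x, hx⟩ := (hK 0).isConnected.nonempty
    exact ⟨⟨x, mem_iUnion.2 ⟨0, hx⟩⟩, isPreconnected_iUnion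
      ⟨x, mem_iInter.2 fun n ↦ hm n.zero_le hx⟩ fun n ↦ (hK n).isConnected.2⟩
  · intro x hx
    obtain ⟨n, hn⟩ := mem_iUnion.1 hx
    exact (hK n).isLinePoint hn
  · intro x hx
    obtain ⟨n, hn⟩ := mem_iUnion.1 hx
    exact (((hf n).1.congr (hF n)).continuousAt ((hK n).1.mem_nhds hn)).continuousWithinAt
  · intro x hx y hy hxy
    obtain ⟨n, hn⟩ := mem_iUnion.1 hx
    obtain ⟨m, hn'⟩ := mem_iUnion.1 hy
    have h1 := hm (le_max_left n m) hn
    have h2 := hm (le_max_right n m) hn'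
    rw [hF _ h1, hF _ h2] at hxy
    exact (hf _).2.1 h1 h2 hxy

theorem isFreeOpenInterval_sUnion_of_isChain [SecondCountableTopology X] {c : Set (Set X)}
    (hc : ∀ K ∈ c, IsFreeOpenInterval K) (hchain : IsChain (· ⊆ ·) c) (hne : c.Nonempty) :
    IsFreeOpenInterval (⋃₀ c) := by
  obtain ⟨T, hTc, hTsub, hTU⟩ :=
    TopologicalSpace.isOpen_sUnion_countable c fun K hK ↦ (hc K hK).1
  have hTne : T.Nonempty := by
    by_contra! h
    obtain ⟨K, hK⟩ := hne
    obtain ⟨x, hx⟩ := (hc K hK).isConnected.nonempty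
    have : x ∈ ⋃₀ T := hTU ▸ mem_sUnion_of_mem hx hK
    simp [h] at this
  have : Encodable T := hTc.toEncodable
  have : Inhabited T := ⟨⟨_, hTne.some_mem⟩⟩
  have hdir : Directed (· ≤ ·) (Subtype.val : T → Set X) :=
    (hchain.mono hTsub).directed
  have heq : ⋃₀ c = ⋃ n, (Subtype.val ∘ hdir.sequence Subtype.val) n := by
    rw [← hTU]
    refine Subset.antisymm (sUnion_subset fun K hK ↦ ?_) (iUnion_subset fun n ↦ ?_)
    · exact (hdir.le_sequence ⟨K, hK⟩).trans
        (subset_iUnion (Subtype.val ∘ hdir.sequence Subtype.val) _)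
    · exact subset_sUnion_of_mem (hdir.sequence _ n).2
  rw [heq]
  exact isFreeOpenInterval_iUnion_of_monotone (fun n ↦ hc _ (hTsub (hdir.sequence _ n).2))
    hdir.sequence_mono

theorem IsFreeOpenInterval.exists_isMaxFreeOpenInterval [SecondCountableTopology X] {I : Set X}
    (hI : IsFreeOpenInterval I) : ∃ J, IsMaxFreeOpenInterval J ∧ I ⊆ J := by
  obtain ⟨J, hIJ, hJ⟩ := zorn_subset_nonempty {K : Set X | IsFreeOpenInterval K}
    (fun c hc hchain hne ↦ ⟨⋃₀ c, isFreeOpenInterval_sUnion_of_isChain hc hchain hne,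
      fun s hs ↦ subset_sUnion_of_mem hs⟩) I hI
  exact ⟨J, ⟨hJ.prop, fun K hK hJK ↦ hJ.eq_of_subset hK hJK⟩, hIJ⟩

theorem IsPreconnected.inter_frontier_nonempty_of_isOpen {s V : Set X} (hs : IsPreconnected s)
    (hV : IsOpen V) (h : (s ∩ V).Nonempty) (h' : (s ∩ Vᶜ).Nonempty) :
    (s ∩ frontier V).Nonempty := by
  by_contra! he
  have hcl : ∀ x ∈ s, x ∉ V → x ∉ closure V := fun x hx hxV hxc ↦ by
    have : x ∈ s ∩ frontier V := ⟨hx, hV.frontier_eq ▸ ⟨hxc, hxV⟩⟩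
    simp [he] at this
  obtain ⟨y, hys, hyV⟩ := h'
  obtain ⟨x, -, hxV, hxc⟩ := hs V (closure V)ᶜ hV isClosed_closure.isOpen_compl
    (fun x hx ↦ (em (x ∈ V)).imp id (hcl x hx)) h ⟨y, hys, hcl y hys hyV⟩
  exact hxc (subset_closure hxV)

theorem IsLinePoint.exists_isOpen_finite_frontier [T2Space X] {q : X} (hq : IsLinePoint q)
    {W : Set X} (hW : W ∈ 𝓝 q) : ∃ V ⊆ W, IsOpen V ∧ q ∈ V ∧ (frontier V).Finite := by
  obtain ⟨g, hg, rfl⟩ := hq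
  obtain ⟨ε, hε, hb⟩ := Metric.nhds_basis_ball.mem_iff.1 (hg.continuous.continuousAt hW)
  rw [Real.ball_eq_Ioo] at hb
  have hV : IsOpen (g '' Ioo (0 - ε) (0 + ε)) := hg.isOpenMap _ isOpen_Ioo
  refine ⟨g '' Ioo (0 - ε) (0 + ε), image_subset_iff.2 hb, hV,
    mem_image_of_mem g ⟨by linarith, by linarith⟩, ?_⟩
  have hcl : closure (g '' Ioo (0 - ε) (0 + ε)) ⊆ g '' Icc (0 - ε) (0 + ε) :=
    closure_minimal (image_mono Ioo_subset_Icc_self) (isCompact_Icc.image hg.continuous).isClosed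
  refine (toFinite {g (0 - ε), g (0 + ε)}).subset ?_
  rw [hV.frontier_eq]
  rintro _ ⟨hx, hx'⟩
  obtain ⟨t, ht, rfl⟩ := hcl hx
  rcases eq_endpoints_or_mem_Ioo_of_mem_Icc ht with rfl | rfl | h
  · simp
  · simp
  · exact absurd (mem_image_of_mem g h) hx'

theorem IsLinePoint.tendsto_atTop_of_mapClusterPt [T2Space X] {q : X} (hq : IsLinePoint q)
    {h : ℝ → X} (hc : Continuous h) (hi : Function.Injective h) (hm : MapClusterPt q atTop h) :
    Tendsto h atTop (𝓝 q) := by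
  intro W hW
  obtain ⟨V, hVW, hV, hqV, hf⟩ := hq.exists_isOpen_finite_frontier hW
  obtain ⟨s, hs⟩ := (hf.preimage hi.injOn).bddAbove
  obtain ⟨t, htV, hst⟩ :=
    ((mapClusterPt_iff_frequently.1 hm V (hV.mem_nhds hqV)).and_eventually
      (eventually_gt_atTop s)).exists
  rw [mem_map]
  filter_upwards [Ioi_mem_atTop s] with u hu
  refine hVW ?_
  by_contra huV
  obtain ⟨_, ⟨v, hv, rfl⟩, hvf⟩ := (isPreconnected_Ioi.image h
    hc.continuousOn).inter_frontier_nonempty_of_isOpen hV ⟨h t, mem_image_of_mem h hst, htV⟩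
    ⟨h u, mem_image_of_mem h hu, huV⟩
  exact (hs hvf).not_gt hv

theorem mapClusterPt_cocompact_of_mem_closure_range [T2Space X] {q : X} {h : ℝ → X}
    (hc : Continuous h) (hq : q ∉ range h) (hcl : q ∈ closure (range h)) :
    MapClusterPt q (cocompact ℝ) h := by
  rw [mapClusterPt_iff_frequently]
  intro V hV
  rw [hasBasis_cocompact.frequently_iff]
  intro K hK
  have hN : V ∩ (h '' K)ᶜ ∈ 𝓝 q :=
    inter_mem hV ((hK.image hc).isClosed.isOpen_compl.mem_nhds fun hqK ↦
      hq (image_subset_range h K hqK))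
  obtain ⟨_, ⟨hxV, hxK⟩, t, rfl⟩ := mem_closure_iff_nhds.1 hcl _ hN
  exact ⟨t, fun htK ↦ hxK (mem_image_of_mem h htK), hxV⟩

theorem spaceIsCircle_of_range_eq_compl_singleton [T2Space X] [CompactSpace X] {q : X}
    {h : ℝ → X} (hh : IsEmbedding h) (hr : range h = {q}ᶜ) : SpaceIsCircle X := by
  have e := OnePoint.equivOfIsEmbeddingOfRangeEq q h hh hr
  have e' := onePointEquivSphereOfFinrankEq (V := ℝ) (ι := Fin 2) (by simp)
  have e'' := Complex.orthonormalBasisOneI.repr.symm.toHomeomorph.subtype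
    (p := fun x ↦ x ∈ sphere (0 : EuclideanSpace ℝ (Fin 2)) 1) (q := fun x ↦ x ∈ sphere (0 : ℂ) 1)
    fun x ↦ by
      rw [mem_sphere_zero_iff_norm, mem_sphere_zero_iff_norm]
      exact (congrArg (· = (1 : ℝ))
        (LinearIsometryEquiv.norm_map Complex.orthonormalBasisOneI.repr.symm x).symm).to_iff
  exact ⟨e.symm.trans (e'.trans e'')⟩

theorem IsLinePoint.spaceIsCircle_of_tendsto [T2Space X] [CompactSpace X] [ConnectedSpace X]
    {q : X} (hq : IsLinePoint q) {h : ℝ → X} (hh : IsOpenEmbedding h) (hqr : q ∉ range h)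
    (ht : Tendsto h atTop (𝓝 q)) (hb : Tendsto h atBot (𝓝 q)) : SpaceIsCircle X := by
  have hl : ∀ t, IsLinePoint (h t) := fun t ↦
    (isFreeOpenInterval_iff.2 ⟨h, hh, rfl⟩).isLinePoint (mem_range_self t)
  let k : ℝ → X := fun t ↦ if t = 0 then q else h (-t⁻¹)
  have hk0 : k 0 = q := if_pos rfl
  have hk : ∀ t, t ≠ 0 → k t = h (-t⁻¹) := fun t ht ↦ if_neg ht
  have hkc : Continuous k := by
    rw [continuous_iff_continuousAt]
    intro t
    rcases eq_or_ne t 0 with rfl | ht0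
    · rw [continuousAt_iff_continuous_left'_right', ContinuousWithinAt, ContinuousWithinAt, hk0]
      constructor
      · refine (ht.comp (tendsto_neg_atBot_atTop.comp tendsto_inv_nhdsLT_zero)).congr' ?_
        filter_upwards [self_mem_nhdsWithin] with t ht using (hk t (ne_of_lt ht)).symm
      · refine (hb.comp (tendsto_neg_atTop_atBot.comp tendsto_inv_nhdsGT_zero)).congr' ?_
        filter_upwards [self_mem_nhdsWithin] with t ht using (hk t (ne_of_gt ht)).symm
    · have : ContinuousAt (fun t ↦ h (-t⁻¹)) t :=
        hh.continuous.continuousAt.comp (continuousAt_inv₀ ht0).neg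
      refine this.congr ?_
      filter_upwards [isOpen_ne.mem_nhds ht0] with t ht using (hk t ht).symm
  have hki : Function.Injective k := by
    intro s t hst
    rcases eq_or_ne s 0 with rfl | hs0 <;> rcases eq_or_ne t 0 with rfl | ht0
    · rfl
    · rw [hk0, hk t ht0] at hst
      exact absurd ⟨_, hst.symm⟩ hqr
    · rw [hk0, hk s hs0] at hst
      exact absurd ⟨_, hst⟩ hqr
    · rw [hk s hs0, hk t ht0] at hst
      simpa using hh.injective hst
  have hko := isOpenEmbedding_of_isLinePoint hkc hki fun t ↦ by
    rcases eq_or_ne t 0 with rfl | ht0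
    · rwa [hk0]
    · rw [hk t ht0]; exact hl _
  have hrange : insert q (range h) = range k ∪ range h := by
    refine Subset.antisymm (insert_subset (Or.inl ⟨0, hk0⟩) subset_union_right)
      (union_subset ?_ (subset_insert _ _))
    rintro _ ⟨t, rfl⟩
    rcases eq_or_ne t 0 with rfl | ht0
    · exact Or.inl hk0
    · exact Or.inr ⟨_, (hk t ht0).symm⟩
  have hopen : IsOpen (insert q (range h)) := hrange ▸ hko.isOpen_range.union hh.isOpen_range
  have hclosed : IsClosed (insert q (range h)) := by
    rw [← closure_subset_iff_isClosed, insert_eq, closure_union, closure_singleton]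
    refine union_subset subset_union_left fun z hz ↦ ?_
    by_contra hzn
    rw [mem_union, not_or] at hzn
    have hmc := mapClusterPt_cocompact_of_mem_closure_range hh.continuous hzn.2 hz
    rw [cocompact_eq_atBot_atTop] at hmc
    have : Tendsto h (atBot ⊔ atTop) (𝓝 q) := hb.sup ht
    exact hzn.1 (eq_of_nhds_neBot (hmc.clusterPt.mono this))
  have huniv := IsClopen.eq_univ ⟨hclosed, hopen⟩ ⟨q, mem_insert _ _⟩
  refine spaceIsCircle_of_range_eq_compl_singleton (q := q) hh.isEmbedding ?_
  refine Subset.antisymm (fun x hx hxq ↦ hqr (hxq ▸ hx)) fun x hx ↦ ?_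
  have : x ∈ insert q (range h) := huniv ▸ mem_univ x
  exact this.resolve_left hx

/-- A line that converges at one end only, to a point which is locally a line, can be continued
past that point. -/
theorem IsLinePoint.exists_ssubset_of_tendsto [T2Space X] {q : X} (hq : IsLinePoint q)
    {h : ℝ → X} (hh : IsOpenEmbedding h) (hqr : q ∉ range h) (ht : Tendsto h atTop (𝓝 q))
    (hb : ¬ MapClusterPt q atBot h) : ∃ K, IsFreeOpenInterval K ∧ range h ⊂ K := by
  have hl : ∀ t, IsLinePoint (h t) := fun t ↦
    (isFreeOpenInterval_iff.2 ⟨h, hh, rfl⟩).isLinePoint (mem_range_self t)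
  obtain ⟨g, hg, hgq, s, hs⟩ : ∃ g : ℝ → X, IsOpenEmbedding g ∧ g 0 = q ∧
      ∃ s, ∀ t > s, ∃ u < 0, h t = g u := by
    obtain ⟨g, hg, hgq⟩ := hq
    let e := (hg.toOpenPartialHomeomorph g).symm
    have hes : e.source = range g := by simp [e]
    have hge : ∀ x ∈ range g, g (e x) = x := fun x hx ↦ e.left_inv (hes ▸ hx)
    obtain ⟨s, hs⟩ := mem_atTop_sets.1
      (ht (hg.isOpen_range.mem_nhds ⟨0, hgq⟩))
    have hmaps : MapsTo h (Ioi s) e.source := fun t ht ↦ by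
      rw [hes]; exact hs t (le_of_lt ht)
    have hconn : IsPreconnected ((e ∘ h) '' Ioi s) := isPreconnected_Ioi.image _
      (e.continuousOn.comp hh.continuous.continuousOn hmaps)
    have hne : ∀ t > s, e (h t) ≠ 0 := fun t ht h0 ↦ hqr ⟨t, by
      rw [← hgq, ← h0, hge _ (hs t (le_of_lt ht))]⟩
    by_cases hneg : ∃ t > s, e (h t) < 0
    · refine ⟨g, hg, hgq, s, fun t ht ↦ ⟨e (h t), ?_, (hge _ (hs t (le_of_lt ht))).symm⟩⟩
      by_contra! hnn
      obtain ⟨t', ht', hlt⟩ := hneg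
      obtain ⟨u, hu, hu0⟩ := hconn.ordConnected.out (mem_image_of_mem (e ∘ h) ht')
        (mem_image_of_mem (e ∘ h) ht) ⟨hlt.le, hnn⟩
      exact hne u hu hu0
    · push Not at hneg
      refine ⟨fun t ↦ g (-t), hg.comp (Homeomorph.neg ℝ).isOpenEmbedding, by simpa using hgq, s,
        fun t ht ↦ ⟨-e (h t), ?_, ?_⟩⟩
      · exact neg_lt_zero.2 ((hneg t ht).lt_of_ne (hne t ht).symm)
      · simpa using (hge _ (hs t (le_of_lt ht))).symm
  obtain ⟨ε, hε, hdisj⟩ : ∃ ε > 0, ∀ u, 0 ≤ u → u < ε → g u ∉ range h := by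
    rw [mapClusterPt_iff_frequently] at hb
    push Not at hb
    obtain ⟨V, hV, hVb⟩ := hb
    obtain ⟨s', hs'⟩ := eventually_atBot.1 hVb
    have hN : V ∩ (h '' Icc s' s)ᶜ ∈ 𝓝 (g 0) := hgq ▸
      inter_mem hV ((isCompact_Icc.image hh.continuous).isClosed.isOpen_compl.mem_nhds fun hqK ↦
        hqr (image_subset_range h _ hqK))
    obtain ⟨ε, hε, hball⟩ := Metric.mem_nhds_iff.1 (hg.continuous.continuousAt hN)
    refine ⟨ε, hε, ?_⟩
    rintro u hu0 hu ⟨t, htu⟩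
    have huN : g u ∈ V ∩ (h '' Icc s' s)ᶜ := hball (by
      rw [Metric.mem_ball, Real.dist_eq, sub_zero, abs_of_nonneg hu0]; exact hu)
    rw [← htu] at huN
    rcases le_or_gt t s' with h1 | h1
    · exact hs' t h1 huN.1
    · rcases le_or_gt t s with h2 | h2
      · exact huN.2 (mem_image_of_mem h ⟨h1.le, h2⟩)
      · obtain ⟨v, hv, hvt⟩ := hs t h2
        exact (hu0.trans_lt' hv).ne (hg.injective (hvt.symm.trans htu))
  let r : ℝ → ℝ := fun t ↦ ε * (t / (1 + t))
  have hr0 : ∀ t, 0 ≤ t → 0 ≤ r t := fun t ht ↦ by positivity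
  have hrε : ∀ t, 0 ≤ t → r t < ε := fun t ht ↦
    mul_lt_of_lt_one_right hε ((div_lt_one (by linarith)).2 (by linarith))
  have hrc : ∀ t, 0 ≤ t → ContinuousAt r t := fun t ht ↦
    continuousAt_const.mul (continuousAt_id.div (continuousAt_const.add continuousAt_id)
      (by positivity))
  let k : ℝ → X := fun t ↦ if t < 0 then h (-Real.log t) else g (r t)
  have hkneg : ∀ t < 0, k t = h (-Real.log t) := fun t ht ↦ if_pos ht
  have hkpos : ∀ t, 0 ≤ t → k t = g (r t) := fun t ht ↦ if_neg ht.not_gt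
  have hk0 : k 0 = q := by rw [hkpos 0 le_rfl, ← hgq]; simp [r]
  have hkc : Continuous k := by
    rw [continuous_iff_continuousAt]
    intro t
    rcases lt_trichotomy t 0 with ht0 | rfl | ht0
    · have : ContinuousAt (fun t ↦ h (-Real.log t)) t :=
        hh.continuous.continuousAt.comp (Real.continuousAt_log ht0.ne).neg
      refine this.congr ?_
      filter_upwards [Iio_mem_nhds ht0] with t ht using (hkneg t ht).symm
    · rw [continuousAt_iff_continuous_left'_right']
      constructor
      · rw [ContinuousWithinAt, hk0]
        refine (ht.comp (tendsto_neg_atBot_atTop.comp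
          (Real.tendsto_log_nhdsNE_zero.mono_left
            (nhdsWithin_mono _ fun x hx ↦ ne_of_lt hx)))).congr' ?_
        filter_upwards [self_mem_nhdsWithin] with t ht using (hkneg t ht).symm
      · exact (hg.continuous.continuousAt.comp (hrc 0 le_rfl)).continuousWithinAt.congr
          (fun t ht ↦ hkpos t (le_of_lt ht)) (hkpos 0 le_rfl)
    · have : ContinuousAt (fun t ↦ g (r t)) t :=
        hg.continuous.continuousAt.comp (hrc t ht0.le)
      refine this.congr ?_
      filter_upwards [Ioi_mem_nhds ht0] with t ht using (hkpos t (le_of_lt ht)).symm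
  have hki : Function.Injective k := by
    intro s t hst
    rcases lt_or_ge s 0 with hs0 | hs0 <;> rcases lt_or_ge t 0 with ht0 | ht0
    · rw [hkneg s hs0, hkneg t ht0] at hst
      have := neg_injective (hh.injective hst)
      rw [← Real.log_neg_eq_log s, ← Real.log_neg_eq_log t] at this
      exact neg_injective (Real.log_injOn_pos (neg_pos.2 hs0) (neg_pos.2 ht0) this)
    · rw [hkneg s hs0, hkpos t ht0] at hst
      exact absurd ⟨_, hst⟩ (hdisj _ (hr0 t ht0) (hrε t ht0))
    · rw [hkpos s hs0, hkneg t ht0] at hst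
      exact absurd ⟨_, hst.symm⟩ (hdisj _ (hr0 s hs0) (hrε s hs0))
    · rw [hkpos s hs0, hkpos t ht0] at hst
      have := mul_left_cancel₀ hε.ne' (hg.injective hst)
      rw [div_eq_div_iff (by positivity) (by positivity)] at this
      linarith
  have hko := isOpenEmbedding_of_isLinePoint hkc hki fun t ↦ by
    rcases lt_or_ge t 0 with ht0 | ht0
    · rw [hkneg t ht0]; exact hl _
    · rw [hkpos t ht0]
      exact (isFreeOpenInterval_iff.2 ⟨g, hg, rfl⟩).isLinePoint (mem_range_self _)
  refine ⟨range k, isFreeOpenInterval_iff.2 ⟨k, hko, rfl⟩, ?_, fun hsub ↦ hqr (hsub ⟨0, hk0⟩)⟩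
  rintro _ ⟨t, rfl⟩
  refine ⟨-Real.exp (-t), ?_⟩
  rw [hkneg _ (neg_lt_zero.2 (Real.exp_pos _)), Real.log_neg_eq_log, Real.log_exp, neg_neg]

theorem IsMaxFreeOpenInterval.subset_of_inter_nonempty [T2Space X] [CompactSpace X]
    [ConnectedSpace X] (hcirc : ¬ SpaceIsCircle X) {J L : Set X} (hJ : IsMaxFreeOpenInterval J)
    (hL : IsFreeOpenInterval L) (hJL : (L ∩ J).Nonempty) : L ⊆ J := by
  by_contra hsub
  obtain ⟨q, hqL, hqf⟩ := hL.isConnected.2.inter_frontier_nonempty_of_isOpen hJ.1.1 hJL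
    (inter_compl_nonempty_iff.2 hsub)
  rw [hJ.1.1.frontier_eq] at hqf
  have hq := hL.isLinePoint hqL
  obtain ⟨h, hh, rfl⟩ := isFreeOpenInterval_iff.1 hJ.1
  have hno : ∀ k : ℝ → X, IsOpenEmbedding k → range k = range h →
      Tendsto k atTop (𝓝 q) → MapClusterPt q atBot k := fun k hk hkr ht ↦ by
    by_contra hb
    obtain ⟨K, hK, hlt⟩ := hq.exists_ssubset_of_tendsto hk (hkr ▸ hqf.2) ht hb
    rw [hkr] at hlt
    exact hlt.ne (hJ.2 K hK hlt.subset)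
  let h' : ℝ → X := h ∘ Homeomorph.neg ℝ
  have hh' : IsOpenEmbedding h' := hh.comp (Homeomorph.neg ℝ).isOpenEmbedding
  have hr' : range h' = range h := (Homeomorph.neg ℝ).surjective.range_comp h
  have hbot : MapClusterPt q atBot h ↔ MapClusterPt q atTop h' := by
    rw [MapClusterPt, MapClusterPt, ← Filter.map_map]
    rw [show map (Homeomorph.neg ℝ) atTop = atBot from Filter.map_neg_atTop]
  have htop : MapClusterPt q atTop h ↔ MapClusterPt q atBot h' := by
    rw [MapClusterPt, MapClusterPt, ← Filter.map_map]
    rw [show map (Homeomorph.neg ℝ) atBot = atTop from Filter.map_neg_atBot]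
  have htail := hq.tendsto_atTop_of_mapClusterPt hh.continuous hh.injective
  have htail' := hq.tendsto_atTop_of_mapClusterPt hh'.continuous hh'.injective
  have hor := mapClusterPt_cocompact_of_mem_closure_range hh.continuous hqf.2 hqf.1
  rw [cocompact_eq_atBot_atTop, MapClusterPt, Filter.map_sup, clusterPt_sup] at hor
  have hboth : MapClusterPt q atBot h ∧ MapClusterPt q atTop h := by
    rcases hor with hb | ht
    · exact ⟨hb, htop.2 (hno h' hh' hr' (htail' (hbot.1 hb)))⟩
    · exact ⟨hno h hh rfl (htail ht), ht⟩
  refine hcirc (hq.spaceIsCircle_of_tendsto hh hqf.2 (htail hboth.2) ?_)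
  have := (htail' (hbot.1 hboth.1)).comp tendsto_neg_atBot_atTop
  refine this.congr fun t ↦ ?_
  simp [h']

end

/-- In a nondegenerate Peano continuum having a free arc which is
neither an arc nor a circle, every free open interval is contained in a unique
maximal free open interval. -/
theorem stmt_5 (X : Type*) [MetricSpace X] [CompactSpace X] [ConnectedSpace X]
    [LocallyConnectedSpace X] (hnd : Nontrivial X)
    (hfree : ∃ A : Set X, IsFreeArc A)
    (harc : ¬ SpaceIsArc X) (hcirc : ¬ SpaceIsCircle X)
    (I : Set X) (hI : IsFreeOpenInterval I) :
    ∃! J : Set X, IsMaxFreeOpenInterval J ∧ I ⊆ J := by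
  obtain ⟨J, hJ, hIJ⟩ := hI.exists_isMaxFreeOpenInterval
  refine ⟨J, ⟨hJ, hIJ⟩, fun K ⟨hK, hIK⟩ ↦ hK.2 J hJ.1 ?_⟩
  exact hJ.subset_of_inter_nonempty hcirc hK.1
    (hI.isConnected.nonempty.mono (subset_inter hIK hIJ))
end

section
/- Let X be a nondegenerate Peano continuum having a free arc, which is not a circle. Then any two maximal free open intervals of X are either disjoint or equal. -/
open Set Metric Topology

open Filter

/-- A continuous injection of the line is open at every point it maps into an open copy of the
line. -/
lemma nhds_le_map_of_injective {X : Type*} [TopologicalSpace X] {j m : ℝ → X}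
    (hj : IsOpenEmbedding j) (hm : Continuous m) (hinj : Function.Injective m) {x : ℝ}
    (hx : m x ∈ range j) : 𝓝 (m x) ≤ map m (𝓝 x) := by
  rw [le_map_iff]
  intro V hV
  have hW : V ∩ m ⁻¹' range j ∈ 𝓝 x :=
    inter_mem hV (hm.continuousAt (hj.isOpen_range.mem_nhds hx))
  obtain ⟨ε, hε, hball⟩ := Metric.nhds_basis_closedBall.mem_iff.1 hW
  rw [Real.closedBall_eq_Icc] at hball
  set ψ : ℝ → ℝ := Function.invFun j ∘ m
  have hψ : ∀ y ∈ Icc (x - ε) (x + ε), j (ψ y) = m y := fun y hy =>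
    Function.invFun_eq (hball hy).2
  have hψc : ContinuousOn ψ (Icc (x - ε) (x + ε)) :=
    hj.isInducing.continuousOn_iff.2 (hm.continuousOn.congr hψ)
  have hψi : InjOn ψ (Icc (x - ε) (x + ε)) := fun y hy z hz hyz =>
    hinj (by rw [← hψ y hy, ← hψ z hz, hyz])
  have hl : x - ε ∈ Icc (x - ε) (x + ε) := ⟨le_rfl, by linarith⟩
  have hc : x ∈ Icc (x - ε) (x + ε) := ⟨by linarith, by linarith⟩
  have hr : x + ε ∈ Icc (x - ε) (x + ε) := ⟨by linarith, le_rfl⟩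
  have himg : ψ '' Icc (x - ε) (x + ε) ∈ 𝓝 (ψ x) := by
    rcases hψc.strictMonoOn_of_injOn_Icc' (by linarith) hψi with h | h
    · exact mem_of_superset (Icc_mem_nhds (h hl hc (by linarith)) (h hc hr (by linarith)))
        (intermediate_value_Icc (by linarith) hψc)
    · exact mem_of_superset (Icc_mem_nhds (h hc hr (by linarith)) (h hl hc (by linarith)))
        (intermediate_value_Icc' (by linarith) hψc)
  rw [← hψ x hc]
  refine mem_of_superset (hj.isOpenMap.image_mem_nhds himg) ?_
  rintro _ ⟨_, ⟨y, hy, rfl⟩, rfl⟩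
  rw [hψ y hy]
  exact ⟨y, (hball hy).1, rfl⟩

/-- The end `+∞` of the line `j` converges to `k d` along the arc `k '' Ico a d`. -/
def ApproachesAlong {X : Type*} [TopologicalSpace X] (j k : ℝ → X) (a d : ℝ) : Prop :=
  (∀ x ∈ Ico a d, ∃ s, j s = k x ∧ ∀ t ≥ s, ∃ y ∈ Ico x d, j t = k y) ∧
    Tendsto j atTop (𝓝 (k d))

lemma approachesAlong_of_tendsto {X : Type*} [TopologicalSpace X] {j k : ℝ → X} {φ : ℝ → ℝ}
    {a d : ℝ} (had : a < d) (hk : Continuous k) (hφ : ∀ x ∈ Ico a d, j (φ x) = k x)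
    (hφc : ContinuousOn φ (Ico a d)) (hφt : Tendsto φ (𝓝[<] d) atTop) :
    ApproachesAlong j k a d := by
  have key : ∀ x ∈ Ico a d, ∀ t ≥ φ x, ∃ y ∈ Ico x d, j t = k y := by
    intro x hx t ht
    obtain ⟨y, hty, hy⟩ := ((hφt.eventually_ge_atTop t).and (Ioo_mem_nhdsLT hx.2)).exists
    obtain ⟨z, hz, rfl⟩ := intermediate_value_Icc hy.1.le
      (hφc.mono (Icc_subset_Ico_iff hy.1.le |>.2 ⟨hx.1, hy.2⟩)) ⟨ht, hty⟩
    exact ⟨z, ⟨hz.1, hz.2.trans_lt hy.2⟩, hφ z ⟨hx.1.trans hz.1, hz.2.trans_lt hy.2⟩⟩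
  refine ⟨fun x hx => ⟨φ x, hφ x hx, key x hx⟩, fun U hU => Filter.mem_map.2 ?_⟩
  obtain ⟨l, hl, hlU⟩ := exists_Ioc_subset_of_mem_nhds (hk.continuousAt hU) ⟨a, had⟩
  obtain ⟨x, hx, hxd⟩ := exists_between (max_lt had hl)
  rw [max_lt_iff] at hx
  filter_upwards [eventually_ge_atTop (φ x)] with t ht
  obtain ⟨y, hy, hty⟩ := key x ⟨hx.1.le, hxd⟩ t ht
  rw [mem_preimage, hty]
  exact hlU ⟨hx.2.trans_le hy.1, hy.2.le⟩

lemma approachesAlong_or_neg {X : Type*} [TopologicalSpace X] [T2Space X] {j k : ℝ → X} {a d : ℝ}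
    (hj : IsOpenEmbedding j) (hk : Continuous k) (had : a < d)
    (hJ : ∀ x ∈ Ico a d, k x ∈ range j) (hd : k d ∉ range j) :
    ApproachesAlong j k a d ∨ ApproachesAlong (j ∘ Neg.neg) k a d := by
  set φ : ℝ → ℝ := Function.invFun j ∘ k
  have hφ : ∀ x ∈ Ico a d, j (φ x) = k x := fun x hx => Function.invFun_eq (hJ x hx)
  have hφc : ContinuousOn φ (Ico a d) :=
    hj.isInducing.continuousOn_iff.2 (hk.continuousOn.congr hφ)
  have hcomp : ∀ C : Set ℝ, IsCompact C → ∀ᶠ x in 𝓝[<] d, φ x ∉ C := by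
    intro C hC
    have hmem : (j '' C)ᶜ ∈ 𝓝 (k d) := (hC.image hj.continuous).isClosed.isOpen_compl.mem_nhds
      fun ⟨y, _, hy⟩ => hd ⟨y, hy⟩
    filter_upwards [mem_nhdsWithin_of_mem_nhds (hk.continuousAt hmem), Ico_mem_nhdsLT had]
      with x hx hxd hxC
    exact hx ⟨φ x, hxC, hφ x hxd⟩
  obtain ⟨l, hl, hl0⟩ := (mem_nhdsLT_iff_exists_Ioo_subset' had).1 (hcomp {0} isCompact_singleton)
  have hl : l < d := hl
  have hsub : Ioo (max a l) d ⊆ Ico a d := fun x hx =>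
    ⟨(le_max_left _ _).trans hx.1.le, hx.2⟩
  have hne : ∀ x ∈ Ioo (max a l) d, φ x ≠ 0 := fun x hx =>
    hl0 ⟨(le_max_right _ _).trans_lt hx.1, hx.2⟩
  have hnhds : Ioo (max a l) d ∈ 𝓝[<] d := Ioo_mem_nhdsLT (max_lt had hl)
  have hsign : (∀ x ∈ Ioo (max a l) d, 0 < φ x) ∨ ∀ x ∈ Ioo (max a l) d, φ x < 0 := by
    by_contra! h
    obtain ⟨⟨x, hx, hx0⟩, y, hy, hy0⟩ := h
    obtain ⟨z, hz, hz0⟩ := isPreconnected_Ioo.intermediate_value hx hy (hφc.mono hsub) ⟨hx0, hy0⟩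
    exact hne z hz hz0
  rcases hsign with h | h
  · refine .inl (approachesAlong_of_tendsto had hk hφ hφc (tendsto_atTop.2 fun b => ?_))
    filter_upwards [hcomp (Icc 0 b) isCompact_Icc, hnhds] with x hx hxl
    by_contra! hxb
    exact hx ⟨(h x hxl).le, hxb.le⟩
  · refine .inr (approachesAlong_of_tendsto (φ := -φ) had hk (fun x hx => by simp [hφ x hx])
      hφc.neg (tendsto_atTop.2 fun b => ?_))
    filter_upwards [hcomp (Icc (-b) 0) isCompact_Icc, hnhds] with x hx hxl
    by_contra! hxb
    rw [Pi.neg_apply] at hxb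
    exact hx ⟨by linarith, (h x hxl).le⟩

lemma exists_first_notMem {X : Type*} [TopologicalSpace X] {k : ℝ → X} {O : Set X} {a r : ℝ}
    (hk : Continuous k) (hO : IsOpen O) (har : a ≤ r) (ha : k a ∈ O) (hr : k r ∉ O) :
    ∃ d ∈ Ioc a r, k d ∉ O ∧ ∀ x ∈ Ico a d, k x ∈ O := by
  obtain ⟨d, ⟨⟨had, hdr⟩, hd⟩, hmin⟩ :=
    (isCompact_Icc.inter_right (hO.isClosed_compl.preimage hk)).exists_isLeast
      ⟨r, right_mem_Icc.2 har, hr⟩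
  refine ⟨d, ⟨had.lt_of_ne ?_, hdr⟩, hd, fun x hx => ?_⟩
  · rintro rfl
    exact hd ha
  · by_contra hxO
    exact hx.2.not_ge (hmin ⟨⟨hx.1, hx.2.le.trans hdr⟩, hxO⟩)

/-- A line approaching a point of another line, which afterwards avoids it, can be extended. -/
lemma exists_extension_of_approachesAlong {X : Type*} [TopologicalSpace X] {j k : ℝ → X} {a d : ℝ}
    (hj : IsOpenEmbedding j) (hk : IsOpenEmbedding k) (had : a < d)
    (h : ApproachesAlong j k a d) (hd : ∀ x ≥ d, k x ∉ range j) :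
    ∃ m : ℝ → X, IsOpenEmbedding m ∧ range j ⊂ range m := by
  obtain ⟨s, hs, hst⟩ := h.1 a ⟨le_rfl, had⟩
  set m : ℝ → X := fun x => if x ≤ a then j (x - a + s) else k x
  have hml : ∀ x ≤ a, m x = j (x - a + s) := fun x hx => if_pos hx
  have hmr : ∀ x, a < x → m x = k x := fun x hx => if_neg hx.not_ge
  have hmr' : ∀ x, a ≤ x → m x = k x := fun x hx => by
    rcases hx.eq_or_lt with rfl | hx
    · rw [hml _ le_rfl, ← hs]
      simp
    · exact hmr x hx
  have hmc : Continuous m := by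
    refine Continuous.if_le (hj.continuous.comp (by fun_prop)) hk.continuous continuous_id
      continuous_const ?_
    rintro x rfl
    simpa using hs
  have hne : ∀ x ≤ a, ∀ y, a < y → j (x - a + s) ≠ k y := by
    intro x hx y hy hxy
    have hyd : y < d := by
      by_contra! hyd
      exact hd y hyd ⟨_, hxy⟩
    obtain ⟨s', hs', hst'⟩ := h.1 y ⟨hy.le, hyd⟩
    have : s' = x - a + s := hj.injective (hs'.trans hxy.symm)
    obtain ⟨z, hz, hsz⟩ := hst' s (by linarith)
    have : a = z := hk.injective (hs.symm.trans hsz)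
    linarith [hz.1]
  have hmi : Function.Injective m := by
    intro x y hxy
    rcases le_or_gt x a with hx | hx <;> rcases le_or_gt y a with hy | hy
    · rw [hml x hx, hml y hy] at hxy
      linarith [hj.injective hxy]
    · rw [hml x hx, hmr y hy] at hxy
      exact (hne x hx y hy hxy).elim
    · rw [hmr x hx, hml y hy] at hxy
      exact (hne y hy x hx hxy.symm).elim
    · rw [hmr x hx, hmr y hy] at hxy
      exact hk.injective hxy
  refine ⟨m, .of_continuous_injective_isOpenMap hmc hmi (.of_nhds_le fun x => ?_),
    fun p hp => ?_, fun hsub => hd d le_rfl (hsub ⟨d, hmr d had⟩)⟩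
  · rcases le_or_gt x a with hx | hx
    · exact nhds_le_map_of_injective hj hmc hmi (hml x hx ▸ mem_range_self _)
    · exact nhds_le_map_of_injective hk hmc hmi (hmr x hx ▸ mem_range_self _)
  · obtain ⟨t, rfl⟩ := hp
    rcases le_or_gt t s with ht | ht
    · refine ⟨t - s + a, ?_⟩
      rw [hml _ (by linarith)]
      congr 1
      ring
    · obtain ⟨y, hy, hty⟩ := hst t ht.le
      exact ⟨y, by rw [hmr' y hy.1, hty]⟩

/-- A line approaching a point of another line, which immediately re-enters it, closes up. -/
lemma isClopen_insert_of_approachesAlong {X : Type*} [TopologicalSpace X] [T2Space X]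
    {j k : ℝ → X} {a d : ℝ} (hj : IsOpenEmbedding j) (hk : IsOpenEmbedding k) (had : a < d)
    (hJ : ∀ x ∈ Ico a d, k x ∈ range j) (hd : k d ∉ range j) (h : ApproachesAlong j k a d)
    (hre : ∀ e > d, ∃ x ∈ Ioo d e, k x ∈ range j) :
    IsClopen (insert (k d) (range j)) := by
  have back : ∀ x > d, k x ∈ range j →
      ∃ d' ∈ Ico d x, (∀ y ∈ Ioc d' x, k y ∈ range j) ∧ Tendsto j atBot (𝓝 (k d')) := by
    intro x hx hxj
    have hk' : Continuous (k ∘ Neg.neg) := hk.continuous.comp continuous_neg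
    obtain ⟨c, hc, hcj, hcJ⟩ := exists_first_notMem (k := k ∘ Neg.neg) (a := -x) (r := -d)
      hk' hj.isOpen_range (by linarith) (by simpa using hxj) (by simpa using hd)
    refine ⟨-c, ⟨by linarith [hc.2], by linarith [hc.1]⟩, fun y hy => ?_, ?_⟩
    · simpa using hcJ (-y) ⟨by linarith [hy.2], by linarith [hy.1]⟩
    rcases approachesAlong_or_neg hj hk' hc.1 hcJ hcj with h' | h'
    · have hdc : d = -c := hk.injective (tendsto_nhds_unique h.2 h'.2)
      obtain ⟨s, -, hs⟩ := h.1 a ⟨le_rfl, had⟩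
      obtain ⟨s', -, hs'⟩ := h'.1 (-x) ⟨le_rfl, hc.1⟩
      obtain ⟨y, hy, hty⟩ := hs (max s s') (le_max_left _ _)
      obtain ⟨z, hz, htz⟩ := hs' (max s s') (le_max_right _ _)
      have : y = -z := hk.injective (hty.symm.trans htz)
      linarith [hy.2, hz.2]
    · have := h'.2.comp tendsto_neg_atBot_atTop
      simpa [Function.comp_def] using this
  obtain ⟨x, hx, hxj⟩ := hre (d + 1) (by linarith)
  obtain ⟨d', hd', hJ', hbot⟩ := back x hx.1 hxj
  have hdd : d' = d := by
    refine (hd'.1.eq_or_lt.resolve_right fun hlt => ?_).symm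
    obtain ⟨x', hx', hxj'⟩ := hre d' hlt
    obtain ⟨d'', hd'', -, hbot'⟩ := back x' hx'.1 hxj'
    have : d' = d'' := hk.injective (tendsto_nhds_unique hbot hbot')
    linarith [hx'.2, hd''.2]
  subst hdd
  constructor
  · refine (Tendsto.isCompact_insert_range_of_cocompact ?_ hj.continuous).isClosed
    rw [cocompact_eq_atBot_atTop]
    exact hbot.sup h.2
  · have : insert (k d') (range j) = range j ∪ k '' Ioo a x := by
      ext p
      constructor
      · rintro (rfl | hp)
        · exact .inr ⟨d', ⟨had, hx.1⟩, rfl⟩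
        · exact .inl hp
      · rintro (hp | ⟨y, hy, rfl⟩)
        · exact .inr hp
        · rcases lt_trichotomy y d' with hyd | rfl | hyd
          · exact .inr (hJ y ⟨hy.1.le, hyd⟩)
          · exact .inl rfl
          · exact .inr (hJ' y ⟨hyd, hy.2.le⟩)
    rw [this]
    exact hj.isOpen_range.union (hk.isOpenMap _ isOpen_Ioo)

lemma isOpenEmbedding_sub_exp_neg (e : ℝ) : IsOpenEmbedding fun x : ℝ => e - Real.exp (-x) := by
  have hc : Continuous fun x : ℝ => e - Real.exp (-x) := by fun_prop
  have hi : Function.Injective fun x : ℝ => e - Real.exp (-x) := fun x y hxy => by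
    simpa using hxy
  exact .of_continuous_injective_isOpenMap hc hi (.of_nhds_le fun x =>
    nhds_le_map_of_injective .id hc hi (by simp))

/-- Two overlapping open lines, the first not containing the second: either the first one extends,
or it closes up. -/
lemma exists_extension_or_isClopen_insert {X : Type*} [TopologicalSpace X] [T2Space X]
    {j k : ℝ → X} (hj : IsOpenEmbedding j) (hk : IsOpenEmbedding k)
    (hmeet : (range j ∩ range k).Nonempty) (hsub : ¬ range k ⊆ range j) :
    (∃ m : ℝ → X, IsOpenEmbedding m ∧ range j ⊂ range m) ∨
      ∃ p ∉ range j, IsClopen (insert p (range j)) := by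
  obtain ⟨_, ha, a, rfl⟩ := hmeet
  obtain ⟨_, ⟨r, rfl⟩, hr⟩ := not_subset.1 hsub
  wlog har : a ≤ r generalizing k a r
  · have hrange : range (k ∘ Neg.neg) = range k := neg_surjective.range_comp k
    exact this (k := k ∘ Neg.neg) (hk.comp (Homeomorph.neg ℝ).isOpenEmbedding) (by rwa [hrange])
      (-a) (by simpa using ha) (-r) (by simpa using hr) (by linarith)
  obtain ⟨d, ⟨had, -⟩, hd, hJ⟩ := exists_first_notMem hk.continuous hj.isOpen_range har ha hr
  have hjneg : IsOpenEmbedding (j ∘ Neg.neg) := hj.comp (Homeomorph.neg ℝ).isOpenEmbedding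
  have hjrange : range (j ∘ Neg.neg) = range j := neg_surjective.range_comp j
  by_cases hre : ∀ e > d, ∃ x ∈ Ioo d e, k x ∈ range j
  · refine .inr ⟨k d, hd, ?_⟩
    rcases approachesAlong_or_neg hj hk.continuous had hJ hd with h | h
    · exact isClopen_insert_of_approachesAlong hj hk had hJ hd h hre
    · rw [← hjrange] at hJ hd hre ⊢
      exact isClopen_insert_of_approachesAlong hjneg hk had hJ hd h hre
  · push Not at hre
    obtain ⟨e, hde, he⟩ := hre
    set θ : ℝ → ℝ := fun x => e - Real.exp (-x) with hθ
    have hθm : StrictMono θ := fun x y hxy => by simpa [hθ] using hxy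
    have hθs : ∀ y < e, ∃ x, θ x = y := fun y hy =>
      ⟨-Real.log (e - y), by simp [hθ, Real.exp_log (sub_pos.2 hy)]⟩
    obtain ⟨a, rfl⟩ := hθs a (had.trans hde)
    obtain ⟨d, rfl⟩ := hθs d hde
    have hkθ : IsOpenEmbedding (k ∘ θ) := hk.comp (isOpenEmbedding_sub_exp_neg e)
    have had' : a < d := hθm.lt_iff_lt.1 had
    have hJ' : ∀ x ∈ Ico a d, (k ∘ θ) x ∈ range j := fun x hx =>
      hJ _ ⟨hθm.monotone hx.1, hθm hx.2⟩
    have hd' : ∀ x ≥ d, (k ∘ θ) x ∉ range j := by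
      intro x hx
      rcases hx.eq_or_lt with rfl | hx
      · exact hd
      · exact he _ ⟨hθm hx, by simp [hθ, Real.exp_pos]⟩
    left
    rcases approachesAlong_or_neg hj hkθ.continuous had' hJ' hd with h | h
    · exact exists_extension_of_approachesAlong hj hkθ had' h hd'
    · rw [← hjrange] at hd' ⊢
      exact exists_extension_of_approachesAlong hjneg hkθ had' h hd'

lemma nonempty_homeomorph_real_Ioo : Nonempty (ℝ ≃ₜ Ioo (0:ℝ) 1) := by
  refine ⟨Real.tanOrderIso.symm.toHomeomorph.trans (Homeomorph.sets
    (affineHomeomorph Real.pi (-(Real.pi / 2)) Real.pi_ne_zero) ?_).symm⟩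
  ext x
  have := Real.pi_pos
  simp only [mem_Ioo, mem_preimage, affineHomeomorph_apply]
  constructor
  · rintro ⟨h0, h1⟩
    constructor <;> nlinarith
  · rintro ⟨h0, h1⟩
    constructor <;> nlinarith

lemma isFreeOpenInterval_iff_exists_isOpenEmbedding {X : Type*} [TopologicalSpace X] {J : Set X} :
    IsFreeOpenInterval J ↔ ∃ j : ℝ → X, IsOpenEmbedding j ∧ range j = J := by
  obtain ⟨e⟩ := nonempty_homeomorph_real_Ioo
  constructor
  · rintro ⟨hJ, ⟨f⟩⟩
    refine ⟨Subtype.val ∘ e.trans f.symm, hJ.isOpenEmbedding_subtypeVal.comp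
      (e.trans f.symm).isOpenEmbedding, ?_⟩
    rw [(e.trans f.symm).surjective.range_comp, Subtype.range_val]
  · rintro ⟨j, hj, rfl⟩
    exact ⟨hj.isOpen_range, ⟨hj.isEmbedding.toHomeomorph.symm.trans e⟩⟩

lemma spaceIsCircle_of_range_eq_compl {X : Type*} [TopologicalSpace X] [T2Space X] [CompactSpace X]
    {j : ℝ → X} (hj : IsOpenEmbedding j) {p : X} (hp : range j = {p}ᶜ) : SpaceIsCircle X := by
  let f : OnePoint ℝ ≃ₜ sphere (0 : EuclideanSpace ℝ (Fin 2)) 1 :=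
    onePointEquivSphereOfFinrankEq (by simp)
  let g : sphere (0:ℂ) 1 ≃ₜ sphere (0 : EuclideanSpace ℝ (Fin 2)) 1 :=
    Complex.orthonormalBasisOneI.repr.toHomeomorph.sets (by ext; simp)
  exact ⟨(OnePoint.equivOfIsEmbeddingOfRangeEq p j hj.isEmbedding hp).symm.trans
    (f.trans g.symm)⟩

/-- In a nondegenerate Peano continuum having a free arc which is
not a circle, two maximal free open intervals are either disjoint or equal. -/
theorem stmt_6 (X : Type*) [MetricSpace X] [CompactSpace X] [ConnectedSpace X]
    [LocallyConnectedSpace X] (hnd : Nontrivial X)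
    (hfree : ∃ A : Set X, IsFreeArc A)
    (hcirc : ¬ SpaceIsCircle X)
    (J K : Set X) (hJ : IsMaxFreeOpenInterval J) (hK : IsMaxFreeOpenInterval K) :
    Disjoint J K ∨ J = K := by
  refine or_iff_not_imp_left.2 fun hdisj => ?_
  by_contra hne
  have hKJ : ¬ K ⊆ J := fun h => hne (hK.2 J hJ.1 h).symm
  obtain ⟨j, hj, rfl⟩ := isFreeOpenInterval_iff_exists_isOpenEmbedding.1 hJ.1
  obtain ⟨k, hk, rfl⟩ := isFreeOpenInterval_iff_exists_isOpenEmbedding.1 hK.1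
  rcases exists_extension_or_isClopen_insert hj hk (not_disjoint_iff_nonempty_inter.1 hdisj) hKJ
    with ⟨m, hm, hjm⟩ | ⟨p, hp, hclopen⟩
  · exact hjm.ne (hJ.2 _ (isFreeOpenInterval_iff_exists_isOpenEmbedding.2 ⟨m, hm, rfl⟩) hjm.subset)
  · have huniv := hclopen.eq_univ (insert_nonempty _ _)
    refine hcirc (spaceIsCircle_of_range_eq_compl hj (p := p) ?_)
    ext x
    constructor
    · rintro hx rfl
      exact hp hx
    · exact fun hx => (huniv ▸ mem_univ x : x ∈ insert p (range j)).resolve_left hx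
end

section
/- Let X be a Peano continuum having a free arc, which is neither an arc nor a circle, and let f : X → X be a continuous open map. If A is a free arc in X contained in a maximal free open interval J, then f(A) is also a free arc in X. -/
open Set Metric Topology

/-- A preconnected set avoiding the images of the end points of an interval is contained in the
open image of that interval as soon as it meets it. -/
lemma IsPreconnected.subset_image_Ioo {X : Type*} [TopologicalSpace X] [T2Space X] {g : ℝ → X}
    (hg : Continuous g) (hgo : IsOpenMap g) {D : Set X} (hD : IsPreconnected D) {s t : ℝ}
    (hs : g s ∉ D) (ht : g t ∉ D) (hne : (D ∩ g '' Ioo s t).Nonempty) : D ⊆ g '' Ioo s t := by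
  refine hD.subset_of_closure_inter_subset (hgo _ isOpen_Ioo) hne ?_
  rintro y ⟨hy, hyD⟩
  have hcl : closure (g '' Ioo s t) ⊆ g '' Icc s t :=
    closure_minimal (image_mono Ioo_subset_Icc_self) (isCompact_Icc.image hg).isClosed
  obtain ⟨x, hx, rfl⟩ := hcl hy
  refine ⟨x, ⟨lt_of_le_of_ne hx.1 ?_, lt_of_le_of_ne hx.2 ?_⟩, rfl⟩
  · rintro rfl; exact hs hyD
  · rintro rfl; exact ht hyD

/-- If an open path returns to its starting point without covering the space, the starting point
is not interior to the covered set. -/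
lemma notMem_interior_image_Icc {X : Type*} [TopologicalSpace X] [T2Space X] [ConnectedSpace X]
    {g : ℝ → X} (hg : Continuous g) (hgo : IsOpenMap g) {s t : ℝ} (hst : s < t) (h : g s = g t)
    (hne : g '' Icc s t ≠ univ) : g s ∉ interior (g '' Icc s t) := by
  intro hi
  have hsub : g '' Ioo s t ⊆ interior (g '' Icc s t) :=
    interior_maximal (image_mono Ioo_subset_Icc_self) (hgo _ isOpen_Ioo)
  have hopen : IsOpen (g '' Icc s t) := by
    rw [← subset_interior_iff_isOpen]
    rintro _ ⟨x, hx, rfl⟩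
    rcases eq_or_lt_of_le hx.1 with rfl | h1
    · exact hi
    rcases eq_or_lt_of_le hx.2 with rfl | h2
    · rwa [← h]
    exact hsub ⟨x, ⟨h1, h2⟩, rfl⟩
  rcases isClopen_iff.1 ⟨(isCompact_Icc.image hg).isClosed, hopen⟩ with h0 | h0
  · exact ((nonempty_Icc.2 hst.le).image g).ne_empty h0
  · exact hne h0

/-- An open path that closes up on `[s, t]` without covering the space arrives at `s` from
outside the image of `[s, t]`. -/
lemma exists_left_notMem_image_Icc {X : Type*} [TopologicalSpace X] [T2Space X] [ConnectedSpace X]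
    [LocallyConnectedSpace X]
    {g : ℝ → X} (hg : Continuous g) (hgo : IsOpenMap g) {s t : ℝ} (hst : s < t) (h : g s = g t)
    (hne : g '' Icc s t ≠ univ) :
    ∃ η > 0, ∀ x ∈ Ioo (s - η) s, g x ∉ g '' Icc s t := by
  have hint := notMem_interior_image_Icc hg hgo hst h hne
  have hIoo : g s ∉ g '' Ioo s t := fun hq =>
    hint (interior_maximal (image_mono Ioo_subset_Icc_self) (hgo _ isOpen_Ioo) hq)
  have hmem : ∀ y ∈ g '' Icc s t, y ≠ g s → y ∈ g '' Ioo s t := by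
    rintro _ ⟨x, hx, rfl⟩ hxs
    refine ⟨x, ⟨lt_of_le_of_ne hx.1 ?_, lt_of_le_of_ne hx.2 ?_⟩, rfl⟩
    · rintro rfl; exact hxs rfl
    · rintro rfl; exact hxs h.symm
  by_contra! hcon
  have hfib : ∀ η > 0, ∃ w ∈ Ioo (s - η) s, g w = g s := by
    intro η hη
    by_contra! hw
    obtain ⟨z, hz, hzK⟩ := hcon η hη
    have hsub : g '' Ioo (s - η) s ⊆ g '' Ioo s t := by
      refine (isPreconnected_Ioo.image g hg.continuousOn).subset_image_Ioo hg hgo ?_ ?_ ?_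
      · rintro ⟨x, hx, hxs⟩; exact hw x hx hxs
      · rintro ⟨x, hx, hxs⟩; exact hw x hx (hxs.trans h.symm)
      · exact ⟨g z, mem_image_of_mem g hz, hmem _ hzK (hw z hz)⟩
    refine hint (mem_interior.2 ⟨g '' Ioo (s - η) t, ?_, hgo _ isOpen_Ioo,
      ⟨s, ⟨by linarith, hst⟩, rfl⟩⟩)
    rintro _ ⟨x, hx, rfl⟩
    rcases lt_or_ge x s with hxs | hxs
    · exact image_mono Ioo_subset_Icc_self (hsub ⟨x, ⟨hx.1, hxs⟩, rfl⟩)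
    · exact ⟨x, ⟨hxs, hx.2.le⟩, rfl⟩
  obtain ⟨y, hy⟩ := (ne_univ_iff_exists_notMem _).1 hne
  have hys : y ≠ g s := by
    rintro rfl; exact hy ⟨s, left_mem_Icc.2 hst.le, rfl⟩
  set D := connectedComponentIn ({g s}ᶜ : Set X) y with hDdef
  have hyD : y ∈ D := mem_connectedComponentIn hys
  have hDsub : D ⊆ {g s}ᶜ := connectedComponentIn_subset _ _
  have hDpre : IsPreconnected D := isPreconnected_connectedComponentIn
  have hsD : g s ∉ D := fun hh => hDsub hh rfl
  have hDopen : IsOpen D := isOpen_compl_singleton.connectedComponentIn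
  have hDK : ∀ z ∈ D, z ∉ g '' Icc s t := by
    intro z hz hzK
    have := hDpre.subset_image_Ioo hg hgo hsD (h ▸ hsD)
      ⟨z, hz, hmem z hzK (hDsub hz)⟩ hyD
    exact hy (image_mono Ioo_subset_Icc_self this)
  have hscl : g s ∈ closure D := by
    by_contra hs
    have hclosed : IsClosed D := by
      refine isClosed_of_closure_subset ?_
      refine IsPreconnected.subset_connectedComponentIn hDpre.closure (subset_closure hyD) ?_
      intro z hz hzs
      exact hs ((show z = g s from hzs) ▸ hz)
    rcases isClopen_iff.1 ⟨hclosed, hDopen⟩ with h0 | h0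
    · exact (h0 ▸ hyD : y ∈ (∅ : Set X))
    · exact hsD (h0 ▸ mem_univ _)
  obtain ⟨ε, hε, hball⟩ := Metric.isOpen_iff.1 (isOpen_compl_singleton.preimage hg :
    IsOpen (g ⁻¹' {y}ᶜ)) s (Ne.symm hys)
  obtain ⟨w, hw, hws⟩ := hfib ε hε
  obtain ⟨_, ⟨z, hz, rfl⟩, hzD⟩ := mem_closure_iff.1 hscl (g '' Ioo w t) (hgo _ isOpen_Ioo)
    ⟨s, ⟨hw.2, hst⟩, rfl⟩
  have hzs : z < s := by
    by_contra! hzs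
    exact hDK _ hzD ⟨z, ⟨hzs, hz.2.le⟩, rfl⟩
  obtain ⟨x, hx, hxy⟩ := hDpre.subset_image_Ioo hg hgo (hws ▸ hsD) hsD
    ⟨g z, hzD, z, ⟨hz.1, hzs⟩, rfl⟩ hyD
  refine hball (show x ∈ ball s ε from ?_) hxy
  rw [Real.ball_eq_Ioo]
  exact ⟨by linarith [hw.1, hx.1], by linarith [hx.2]⟩

lemma image_comp_neg_Icc {X : Type*} (g : ℝ → X) (s t : ℝ) :
    (fun x => g (-x)) '' Icc (-t) (-s) = g '' Icc s t := by
  rw [← image_image g Neg.neg, image_neg_Icc, neg_neg, neg_neg]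

/-- An open path that closes up on `[s, t]` without covering the space leaves `t` towards the
outside of the image of `[s, t]`. -/
lemma exists_right_notMem_image_Icc {X : Type*} [TopologicalSpace X] [T2Space X]
    [ConnectedSpace X] [LocallyConnectedSpace X]
    {g : ℝ → X} (hg : Continuous g) (hgo : IsOpenMap g) {s t : ℝ} (hst : s < t) (h : g s = g t)
    (hne : g '' Icc s t ≠ univ) :
    ∃ η > 0, ∀ x ∈ Ioo t (t + η), g x ∉ g '' Icc s t := by
  obtain ⟨η, hη, H⟩ := exists_left_notMem_image_Icc (g := fun x => g (-x)) (s := -t) (t := -s)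
    (hg.comp continuous_neg) (hgo.comp (Homeomorph.neg ℝ).isOpenMap) (neg_lt_neg hst)
    (by simpa using h.symm) (by rwa [image_comp_neg_Icc])
  refine ⟨η, hη, fun x hx => ?_⟩
  have := H (-x) ⟨by linarith [hx.2], by linarith [hx.1]⟩
  rwa [image_comp_neg_Icc, neg_neg] at this

lemma exists_image_Icc_left_subset {X : Type*} [TopologicalSpace X] [T2Space X]
    [ConnectedSpace X] [LocallyConnectedSpace X]
    {g : ℝ → X} (hg : Continuous g) (hgo : IsOpenMap g) {s t : ℝ} (hst : s < t) (h : g s = g t)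
    (hne : g '' Icc s t ≠ univ) :
    ∃ u ∈ Ioo s t, g '' Icc s u ⊆ g '' Icc u t := by
  obtain ⟨η, hη, H⟩ := exists_right_notMem_image_Icc hg hgo hst h hne
  have hV : IsOpen (g ⁻¹' (g '' Ioo ((s + t) / 2) (t + η))) := (hgo _ isOpen_Ioo).preimage hg
  obtain ⟨ε, hε, hball⟩ := Metric.isOpen_iff.1 hV s
    ⟨t, ⟨by linarith, by linarith⟩, h.symm⟩
  rw [Real.ball_eq_Ioo] at hball
  have hm : 0 < min ε (t - s) := lt_min hε (by linarith)
  have h1 := min_le_left ε (t - s)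
  have h2 := min_le_right ε (t - s)
  refine ⟨s + min ε (t - s) / 2, ⟨by linarith, by linarith⟩, ?_⟩
  rintro _ ⟨x, hx, rfl⟩
  obtain ⟨y, hy, hyx⟩ := hball (show x ∈ Ioo (s - ε) (s + ε) from
    ⟨by linarith [hx.1], by linarith [hx.2]⟩)
  refine ⟨y, ⟨by linarith [hy.1], ?_⟩, hyx⟩
  by_contra! hyt
  exact H y ⟨hyt, hy.2⟩ ⟨x, ⟨hx.1, by linarith [hx.2]⟩, hyx.symm⟩

lemma exists_image_Icc_right_subset {X : Type*} [TopologicalSpace X] [T2Space X]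
    [ConnectedSpace X] [LocallyConnectedSpace X]
    {g : ℝ → X} (hg : Continuous g) (hgo : IsOpenMap g) {s t : ℝ} (hst : s < t) (h : g s = g t)
    (hne : g '' Icc s t ≠ univ) :
    ∃ u ∈ Ioo s t, g '' Icc u t ⊆ g '' Icc s u := by
  obtain ⟨u, hu, H⟩ := exists_image_Icc_left_subset (g := fun x => g (-x)) (s := -t) (t := -s)
    (hg.comp continuous_neg) (hgo.comp (Homeomorph.neg ℝ).isOpenMap) (neg_lt_neg hst)
    (by simpa using h.symm) (by rwa [image_comp_neg_Icc])
  obtain ⟨v, rfl⟩ : ∃ v, u = -v := ⟨-u, (neg_neg u).symm⟩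
  rw [image_comp_neg_Icc, image_comp_neg_Icc] at H
  exact ⟨v, ⟨by linarith [hu.2], by linarith [hu.1]⟩, H⟩

/-- A coincidence `g s = g t` of an open path that does not cover the space on `[s, t]` extends
outwards. -/
lemma exists_outer_eq {X : Type*} [TopologicalSpace X] [T2Space X]
    [ConnectedSpace X] [LocallyConnectedSpace X]
    {g : ℝ → X} (hg : Continuous g) (hgo : IsOpenMap g) {s t : ℝ} (hst : s < t) (h : g s = g t)
    (hne : g '' Icc s t ≠ univ) {l r : ℝ} (hl : l < s) (hr : t < r) :
    ∃ s' ∈ Ioo l s, ∃ t' ∈ Ioo t r, g s' = g t' := by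
  obtain ⟨η, hη, H⟩ := exists_right_notMem_image_Icc hg hgo hst h hne
  have hV : IsOpen (g ⁻¹' (g '' Ioo l t)) := (hgo _ isOpen_Ioo).preimage hg
  obtain ⟨ε, hε, hball⟩ := Metric.isOpen_iff.1 hV t ⟨s, ⟨hl, hst⟩, h⟩
  rw [Real.ball_eq_Ioo] at hball
  obtain ⟨t', ht, ht'⟩ := exists_between (lt_min (lt_min hr (show t < t + η by linarith))
    (show t < t + ε by linarith))
  rw [lt_min_iff, lt_min_iff] at ht'
  obtain ⟨s', hs', hst'⟩ := hball ⟨by linarith, ht'.2⟩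
  refine ⟨s', ⟨hs'.1, ?_⟩, t', ⟨ht, ht'.1.1⟩, hst'⟩
  by_contra! hss
  exact H t' ⟨ht, ht'.1.2⟩ ⟨s', ⟨hss, hs'.2.le⟩, hst'⟩

/-- Among the subintervals of `[a, b]` with the same image there is a shortest one. -/
lemma exists_minimal_Icc_image_eq {X : Type*} [TopologicalSpace X] [T2Space X]
    {g : ℝ → X} (hg : Continuous g) {a b : ℝ} (hab : a ≤ b) :
    ∃ c d, a ≤ c ∧ c ≤ d ∧ d ≤ b ∧ g '' Icc c d = g '' Icc a b ∧
      ∀ c' d', c ≤ c' → d' ≤ d → g '' Icc c d ⊆ g '' Icc c' d' → c' = c ∧ d' = d := by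
  let T : ℝ → Set (ℝ × ℝ × ℝ) := fun y =>
    (Icc a b ×ˢ Icc a b ×ˢ Icc a b) ∩
      ({p | p.1 ≤ p.2.2} ∩ ({p | p.2.2 ≤ p.2.1} ∩ {p | g p.2.2 = g y}))
  have hT : ∀ y, IsCompact (T y) := fun y =>
    (isCompact_Icc.prod (isCompact_Icc.prod isCompact_Icc)).inter_right
      ((isClosed_le (by fun_prop) (by fun_prop)).inter
        ((isClosed_le (by fun_prop) (by fun_prop)).inter
          (isClosed_eq (by fun_prop) (by fun_prop))))
  let π : ℝ × ℝ × ℝ → ℝ × ℝ := fun p => (p.1, p.2.1)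
  have hS : IsCompact ((Icc a b ×ˢ Icc a b) ∩ ⋂ y ∈ Icc a b, π '' T y) :=
    (isCompact_Icc.prod isCompact_Icc).inter_right
      (isClosed_biInter fun y _ => ((hT y).image (by fun_prop)).isClosed)
  obtain ⟨⟨c, d⟩, ⟨⟨hc, hd⟩, hcd⟩, hmin⟩ := hS.exists_isMinOn
    (f := fun p : ℝ × ℝ => p.2 - p.1) ⟨(a, b), ⟨left_mem_Icc.2 hab, right_mem_Icc.2 hab⟩,
      mem_iInter₂.2 fun y hy => ⟨(a, b, y), ⟨⟨left_mem_Icc.2 hab, right_mem_Icc.2 hab, hy⟩,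
        hy.1, hy.2, rfl⟩, rfl⟩⟩ (by fun_prop)
  simp only at hc hd
  have key : ∀ y ∈ Icc a b, ∃ x ∈ Icc c d, g x = g y := by
    intro y hy
    obtain ⟨⟨p, q, x⟩, ⟨-, h1, h2, h3⟩, hp⟩ := mem_iInter₂.1 hcd y hy
    obtain ⟨rfl, rfl⟩ := Prod.mk.inj hp
    exact ⟨x, ⟨h1, h2⟩, h3⟩
  have himg : g '' Icc c d = g '' Icc a b := by
    refine (image_mono (Icc_subset_Icc hc.1 hd.2)).antisymm ?_
    rintro _ ⟨y, hy, rfl⟩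
    exact key y hy
  obtain ⟨x₀, hx₀, -⟩ := key a (left_mem_Icc.2 hab)
  refine ⟨c, d, hc.1, hx₀.1.trans hx₀.2, hd.2, himg, fun c' d' hc' hd' hsub => ?_⟩
  obtain ⟨x₁, hx₁, -⟩ := hsub ⟨x₀, hx₀, rfl⟩
  have hle := hx₁.1.trans hx₁.2
  have hc₁ : c' ∈ Icc a b := ⟨hc.1.trans hc', by linarith [hd.2]⟩
  have hd₁ : d' ∈ Icc a b := ⟨by linarith [hc.1], by linarith [hd.2]⟩
  have := hmin (show (c', d') ∈ _ from ⟨⟨hc₁, hd₁⟩, mem_iInter₂.2 fun y hy => by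
    obtain ⟨x, hx, hxy⟩ := hsub (himg ▸ mem_image_of_mem g hy)
    exact ⟨(c', d', x), ⟨⟨hc₁, hd₁, hc₁.1.trans hx.1, hx.2.trans hd₁.2⟩, hx.1, hx.2, hxy⟩, rfl⟩⟩)
  simp only [mem_ofPred_eq] at this
  constructor <;> linarith

/-- A space covered by a path that is injective except for closing up at its end points is a
circle. -/
lemma spaceIsCircle_of_closed_path {X : Type*} [TopologicalSpace X] [T2Space X] {g : ℝ → X}
    (hg : Continuous g) {c d : ℝ} (hcd : c < d) (hinj : InjOn g (Ico c d)) (h : g c = g d)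
    (huniv : g '' Icc c d = univ) : SpaceIsCircle X := by
  have : Fact (0 < d - c) := ⟨sub_pos.2 hcd⟩
  have hd : c + (d - c) = d := by ring
  let F : AddCircle (d - c) → X := AddCircle.liftIco (d - c) c g
  have hF : Continuous F := AddCircle.liftIco_continuous (by rw [hd]; exact h) hg.continuousOn
  have hval : ∀ x ∈ Ico c d, F (x : AddCircle (d - c)) = g x := fun x hx =>
    AddCircle.liftIco_coe_apply (by rwa [hd])
  have hrep : ∀ z : AddCircle (d - c), ∃ x ∈ Ico c d, (x : AddCircle (d - c)) = z := by
    intro z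
    obtain ⟨x, hx, hxz⟩ := (AddCircle.coe_image_Ico_eq (d - c) c).symm ▸ mem_univ z
    exact ⟨x, by rwa [hd] at hx, hxz⟩
  have hbij : Function.Bijective F := by
    constructor
    · intro z w hzw
      obtain ⟨x, hx, rfl⟩ := hrep z
      obtain ⟨y, hy, rfl⟩ := hrep w
      rw [hval x hx, hval y hy] at hzw
      rw [hinj hx hy hzw]
    · intro y
      obtain ⟨x, hx, rfl⟩ := huniv.symm ▸ mem_univ y
      rcases eq_or_lt_of_le hx.2 with rfl | hxd
      · exact ⟨c, (hval c (left_mem_Ico.2 hcd)).trans h⟩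
      · exact ⟨x, hval x ⟨hx.1, hxd⟩⟩
  let e : AddCircle (d - c) ≃ₜ X :=
    Continuous.homeoOfEquivCompactToT2 (f := Equiv.ofBijective F hbij) hF
  exact ⟨e.symm.trans (AddCircle.homeomorphCircle (sub_pos.2 hcd).ne')⟩

/-- The image of a compact interval under an open path in a space that is not a circle is the
image of a subinterval on which the path is injective. -/
lemma exists_injOn_Icc_image_eq {X : Type*} [TopologicalSpace X] [T2Space X]
    [ConnectedSpace X] [LocallyConnectedSpace X] [Nontrivial X] (hcirc : ¬ SpaceIsCircle X)
    {g : ℝ → X} (hg : Continuous g) (hgo : IsOpenMap g) {a b : ℝ} (hab : a < b) :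
    ∃ c d, c < d ∧ InjOn g (Icc c d) ∧ g '' Icc c d = g '' Icc a b := by
  obtain ⟨c, d, hac, hcd, hdb, himg, hmin⟩ := exists_minimal_Icc_image_eq hg hab.le
  have hcd' : c < d := by
    refine lt_of_le_of_ne hcd ?_
    rintro rfl
    rw [Icc_self, image_singleton] at himg
    have hsing : g '' Ioo a b = {g c} :=
      ((nonempty_Ioo.2 hab).image g).subset_singleton_iff.1
        (himg ▸ image_mono Ioo_subset_Icc_self)
    rcases isClopen_iff.1 ⟨isClosed_singleton, hsing ▸ hgo _ isOpen_Ioo⟩ with h0 | h0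
    · exact singleton_ne_empty _ h0
    · obtain ⟨y, hy⟩ := exists_ne (g c)
      exact hy (h0 ▸ mem_univ y : y ∈ ({g c} : Set X))
  refine ⟨c, d, hcd', ?_, himg⟩
  have hleft : ∀ u ∈ Ioc c d, ¬ g '' Icc c u ⊆ g '' Icc u d := by
    intro u hu hsub
    refine hu.1.ne' (hmin u d hu.1.le le_rfl ?_).1
    rw [← Icc_union_Icc_eq_Icc hu.1.le hu.2, image_union]
    exact union_subset hsub subset_rfl
  have hright : ∀ u ∈ Ico c d, ¬ g '' Icc u d ⊆ g '' Icc c u := by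
    intro u hu hsub
    refine hu.2.ne (hmin c u le_rfl hu.2.le ?_).2
    rw [← Icc_union_Icc_eq_Icc hu.1 hu.2.le, image_union]
    exact union_subset subset_rfl hsub
  have hfold : ∀ s t, c ≤ s → s < t → t ≤ d → g s = g t → g '' Icc s t ≠ univ →
      c < s ∧ t < d := by
    intro s t hcs hst htd h hne
    constructor
    · refine lt_of_le_of_ne hcs ?_
      rintro rfl
      obtain ⟨u, hu, hsub⟩ := exists_image_Icc_left_subset hg hgo hst h hne
      exact hleft u ⟨hu.1, hu.2.le.trans htd⟩
        (hsub.trans (image_mono (Icc_subset_Icc_right htd)))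
    · refine lt_of_le_of_ne htd ?_
      rintro rfl
      obtain ⟨u, hu, hsub⟩ := exists_image_Icc_right_subset hg hgo hst h hne
      exact hright u ⟨hcs.trans hu.1.le, hu.2⟩
        (hsub.trans (image_mono (Icc_subset_Icc_left hcs)))
  have hcover : ∀ s t, c ≤ s → t ≤ d → g '' Icc s t = univ → s = c ∧ t = d := by
    intro s t hcs htd h
    exact hmin s t hcs htd (h ▸ subset_univ _)
  have hnofold : ∀ s t, c ≤ s → s < t → t ≤ d → g s = g t → g '' Icc s t = univ := by
    intro s t hcs hst htd h
    by_contra hne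
    obtain ⟨hcs', htd'⟩ := hfold s t hcs hst htd h hne
    have hpartner : ∀ u ∈ Ioc c s, g u ∈ g '' Icc t d := by
      intro u hu
      have hK : IsCompact ((Icc u s ×ˢ Icc t d) ∩ {p : ℝ × ℝ | g p.1 = g p.2}) :=
        (isCompact_Icc.prod isCompact_Icc).inter_right
          (isClosed_eq (by fun_prop) (by fun_prop))
      obtain ⟨⟨s₁, t₁⟩, ⟨⟨hs₁, ht₁⟩, h₁⟩, hmax⟩ := hK.exists_isMaxOn
        (f := fun p : ℝ × ℝ => p.2 - p.1)
        ⟨(s, t), ⟨right_mem_Icc.2 hu.2, left_mem_Icc.2 htd⟩, h⟩ (by fun_prop)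
      simp only [mem_ofPred_eq] at hs₁ ht₁ h₁
      have hst₁ : s₁ < t₁ := by linarith [hs₁.2, ht₁.1]
      have hcs₁ : c < s₁ := hu.1.trans_le hs₁.1
      have hne₁ : g '' Icc s₁ t₁ ≠ univ := fun hh =>
        hcs₁.ne' (hcover s₁ t₁ hcs₁.le ht₁.2 hh).1
      have htd₁ := (hfold s₁ t₁ hcs₁.le hst₁ ht₁.2 h₁ hne₁).2
      rcases eq_or_lt_of_le hs₁.1 with rfl | hus
      · exact ⟨t₁, ht₁, h₁.symm⟩
      · obtain ⟨s₂, hs₂, t₂, ht₂, h₂⟩ := exists_outer_eq hg hgo hst₁ h₁ hne₁ hus htd₁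
        have := hmax (show (s₂, t₂) ∈ _ from ⟨⟨⟨hs₂.1.le, hs₂.2.le.trans hs₁.2⟩,
          ⟨ht₁.1.trans ht₂.1.le, ht₂.2.le⟩⟩, h₂⟩)
        simp only [mem_ofPred_eq] at this
        linarith [hs₂.2, ht₂.1]
    refine hleft s ⟨hcs', hst.le.trans htd⟩ ?_
    have hcl : Icc c s ⊆ g ⁻¹' (g '' Icc t d) := by
      rw [← closure_Ioc hcs'.ne]
      exact closure_minimal hpartner ((isCompact_Icc.image hg).isClosed.preimage hg)
    exact (image_subset_iff.2 hcl).trans (image_mono (Icc_subset_Icc_left hst.le))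
  have hpair : ∀ s t, c ≤ s → s < t → t ≤ d → g s = g t → s = c ∧ t = d :=
    fun s t hcs hst htd h => hcover s t hcs htd (hnofold s t hcs hst htd h)
  have hcd_ne : g c ≠ g d := by
    intro h
    refine hcirc (spaceIsCircle_of_closed_path hg hcd' ?_ h (hnofold c d le_rfl hcd' le_rfl h))
    intro x hx y hy hxy
    rcases lt_trichotomy x y with hlt | heq | hlt
    · exact absurd (hpair x y hx.1 hlt hy.2.le hxy).2 hy.2.ne
    · exact heq
    · exact absurd (hpair y x hy.1 hlt hx.2.le hxy.symm).2 hx.2.ne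
  intro x hx y hy hxy
  rcases lt_trichotomy x y with hlt | heq | hlt
  · obtain ⟨rfl, rfl⟩ := hpair x y hx.1 hlt hy.2 hxy
    exact absurd hxy hcd_ne
  · exact heq
  · obtain ⟨rfl, rfl⟩ := hpair y x hy.1 hlt hx.2 hxy.symm
    exact absurd hxy.symm hcd_ne

/-- An open path that is injective on a compact interval maps it to a free arc. -/
lemma isFreeArc_image_Icc {X : Type*} [TopologicalSpace X] [T2Space X]
    {g : ℝ → X} (hg : Continuous g) (hgo : IsOpenMap g) {c d : ℝ} (hcd : c < d)
    (hinj : InjOn g (Icc c d)) : IsFreeArc (g '' Icc c d) := by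
  let e : ℝ ≃ₜ ℝ := affineHomeomorph (d - c) c (sub_pos.2 hcd).ne'
  have hIcc : e '' Icc 0 1 = Icc c d := by
    rw [affineHomeomorph_image_Icc (d - c) c 0 1 (sub_pos.2 hcd)]
    congr 1 <;> ring
  have hcl : closure (g '' (e '' Ioo 0 1)) = g '' (e '' Icc 0 1) := by
    refine (closure_minimal (image_mono (image_mono Ioo_subset_Icc_self))
      ((isCompact_Icc.image e.continuous).image hg).isClosed).antisymm ?_
    rw [← closure_Ioo (zero_ne_one' ℝ), e.image_closure]
    exact image_closure_subset_closure_image hg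
  rw [← hIcc] at hinj ⊢
  have hge : Continuous (g ∘ e) := hg.comp e.continuous
  have hgeo : IsOpenMap (g ∘ e) := hgo.comp e.isOpenMap
  have hinj' : InjOn (g ∘ e) (Icc 0 1) := hinj.comp e.injective.injOn (mapsTo_image e _)
  refine ⟨g '' (e '' Ioo 0 1), ⟨?_, ?_⟩, hcl.symm, ?_⟩
  · exact hgo _ (e.isOpenMap _ isOpen_Ioo)
  · rw [← image_comp, ← range_domRestrict]
    have hemb : IsOpenEmbedding ((Ioo (0:ℝ) 1).domRestrict (g ∘ e)) :=
      .of_continuous_injective_isOpenMap (hge.comp continuous_subtype_val)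
        (injOn_iff_injective.1 (hinj'.mono Ioo_subset_Icc_self))
        (hgeo.comp isOpen_Ioo.isOpenMap_subtype_val)
    exact ⟨hemb.isEmbedding.toHomeomorph.symm⟩
  · rw [← image_comp, ← range_domRestrict]
    have hemb : IsClosedEmbedding ((Icc (0:ℝ) 1).domRestrict (g ∘ e)) :=
      (hge.comp continuous_subtype_val).isClosedEmbedding (injOn_iff_injective.1 hinj')
    exact ⟨hemb.isEmbedding.toHomeomorph.symm⟩

/-- The open unit interval is homeomorphic to the real line. -/
lemma nonempty_Ioo_homeomorph_real : Nonempty (Ioo (0:ℝ) 1 ≃ₜ ℝ) := by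
  let e : ℝ ≃ₜ ℝ := affineHomeomorph Real.pi (-(Real.pi / 2)) Real.pi_pos.ne'
  have he : e '' Ioo 0 1 = Ioo (-(Real.pi / 2)) (Real.pi / 2) := by
    rw [affineHomeomorph_image_Ioo _ _ _ _ Real.pi_pos]
    congr 1 <;> ring
  exact ⟨((e.image (Ioo 0 1)).trans (Homeomorph.setCongr he)).trans
    Real.tanOrderIso.toHomeomorph⟩

/-- An arc contained in an open interval is parametrized by a compact interval. -/
lemma IsArc.exists_eq_image_Icc {X : Type*} [TopologicalSpace X] {A : Set X} (hA : IsArc A)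
    {φ : ℝ → X} (hφ : IsEmbedding φ) (hAφ : A ⊆ range φ) :
    ∃ a b, a < b ∧ A = φ '' Icc a b := by
  obtain ⟨e⟩ := hA
  have : CompactSpace A := e.symm.compactSpace
  have : ConnectedSpace A := e.symm.surjective.connectedSpace e.symm.continuous
  have : Nontrivial A := e.toEquiv.nontrivial
  have himg : φ '' (φ ⁻¹' A) = A := image_preimage_eq_of_subset hAφ
  have hcomp : IsCompact (φ ⁻¹' A) := by
    rw [hφ.isCompact_iff, himg]; exact isCompact_iff_compactSpace.2 ‹_›
  have hconn : IsConnected (φ ⁻¹' A) := by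
    have hA' : IsConnected (φ '' (φ ⁻¹' A)) := himg.symm ▸ isConnected_iff_connectedSpace.2 ‹_›
    exact ⟨hA'.nonempty.of_image, hφ.isInducing.isPreconnected_image.1 hA'.isPreconnected⟩
  have hIcc := eq_Icc_of_connected_compact hconn hcomp
  refine ⟨_, _, ?_, by rw [← hIcc, himg]⟩
  by_contra! hle
  have hsub : (φ ⁻¹' A).Subsingleton := hIcc ▸ subsingleton_Icc_of_ge hle
  have hAsub : A.Subsingleton := himg ▸ hsub.image φ
  exact not_subsingleton A hAsub.coe_sort

/-- For a Peano continuum having a free arc, neither an arc nor a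
circle, a continuous open self-map sends a free arc contained in a maximal free
open interval to a free arc. -/
theorem stmt_11 (X : Type*) [MetricSpace X] [CompactSpace X] [ConnectedSpace X]
    [LocallyConnectedSpace X]
    (hfree : ∃ A : Set X, IsFreeArc A)
    (harc : ¬ SpaceIsArc X) (hcirc : ¬ SpaceIsCircle X)
    (f : X → X) (hc : Continuous f) (ho : IsOpenMap f)
    (A J : Set X) (hJ : IsMaxFreeOpenInterval J)
    (hA : IsFreeArc A) (hAJ : A ⊆ J) :
    IsFreeArc (f '' A) := by
  obtain ⟨⟨hJo, ⟨ψ⟩⟩, -⟩ := hJ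
  obtain ⟨-, -, -, hAarc⟩ := hA
  obtain ⟨χ⟩ := nonempty_Ioo_homeomorph_real
  have hφ : IsOpenEmbedding (fun x => ((ψ.trans χ).symm x : X)) :=
    hJo.isOpenEmbedding_subtypeVal.comp (ψ.trans χ).symm.isOpenEmbedding
  obtain ⟨a, b, hab, rfl⟩ := hAarc.exists_eq_image_Icc hφ.isEmbedding
    (fun x hx => ⟨ψ.trans χ ⟨x, hAJ hx⟩, by simp⟩)
  have : Nontrivial X := hφ.injective.nontrivial
  have hg := hc.comp hφ.continuous
  have hgo := ho.comp hφ.isOpenMap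
  obtain ⟨c, d, hcd, hinj, himg⟩ := exists_injOn_Icc_image_eq hcirc hg hgo hab
  rw [← image_comp, ← himg]
  exact isFreeArc_image_Icc hg hgo hcd hinj
end
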